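/- arXiv:0807.1081 — 3 statements merged into one kernel-verified Lean document; each statement's English description precedes it below -/
import Mathlib

section
/- The Jacobi theta-nulls satisfy Jacobi's quartic identity together with a coupled system of nonlinear first-order differential equations: for all τ in the upper half-plane, θ₃⁴ = θ₂⁴ + θ₄⁴, and, setting ℰ₂ := (θ₂⁴)′/θ₂⁴, one has 4·θ₂′ = ℰ₂·θ₂, 4·θ₃′ = (ℰ₂ − θ₄⁴)·θ₃, 4·θ₄′ = (ℰ₂ − θ₃⁴)·θ₄, and 2·ℰ₂′ = ℰ₂² − θ₃⁴·θ₄⁴. -/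
open Complex

noncomputable section

/-- The Jacobi theta-null θ₂. -/
def theta2 (τ : ℂ) : ℂ :=
  ∑' m : ℤ, Complex.exp (2 * Real.pi * Complex.I * τ * ((m : ℂ) + 1 / 2) ^ 2)

/-- The Jacobi theta-null θ₃. -/
def theta3 (τ : ℂ) : ℂ :=
  ∑' m : ℤ, Complex.exp (2 * Real.pi * Complex.I * τ * (m : ℂ) ^ 2)

/-- The Jacobi theta-null θ₄. -/
def theta4 (τ : ℂ) : ℂ :=
  ∑' m : ℤ, (-1 : ℂ) ^ m * Complex.exp (2 * Real.pi * Complex.I * τ * (m : ℂ) ^ 2)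

/-- The derivation f ↦ f′ = (2πi)⁻¹ df/dτ = q d/dq. -/
def dq (f : ℂ → ℂ) : ℂ → ℂ := fun τ => (2 * Real.pi * Complex.I)⁻¹ * deriv f τ

/-- ℰ₂ := (θ₂⁴)′/θ₂⁴. -/
def E2sig : ℂ → ℂ := fun τ => dq (fun t => theta2 t ^ 4) τ / theta2 τ ^ 4

namespace ThetaAux

open Filter Topology

/-- generic lacunary series -/
def T (f : ℤ → ℕ) (q : ℂ) : ℂ := ∑' m : ℤ, q ^ f m

def f3 (m : ℤ) : ℕ := (m ^ 2).toNat
def f2 (m : ℤ) : ℕ := (m ^ 2 + m).toNat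

lemma f3_cast (m : ℤ) : (f3 m : ℤ) = m ^ 2 := Int.toNat_of_nonneg (sq_nonneg m)

lemma f2_cast (m : ℤ) : (f2 m : ℤ) = m ^ 2 + m := by
  apply Int.toNat_of_nonneg
  rcases le_or_gt 0 m with h | h <;> nlinarith

lemma f3_ge (m : ℤ) : m.natAbs ≤ f3 m + 1 := by
  have := f3_cast m
  rcases le_or_gt 0 m with h | h
  · have : m ≤ m ^ 2 + 1 := by nlinarith [sq_nonneg (m - 1)]
    omega
  · have : -m ≤ m ^ 2 + 1 := by nlinarith [sq_nonneg (m + 1)]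
    omega

lemma f2_ge (m : ℤ) : m.natAbs ≤ f2 m + 1 := by
  have := f2_cast m
  rcases le_or_gt 0 m with h | h
  · have : m ≤ m ^ 2 + m + 1 := by nlinarith [sq_nonneg (m - 1)]
    omega
  · have : -m ≤ m ^ 2 + m + 1 := by nlinarith [sq_nonneg (m + 1)]
    omega

lemma summable_natAbs {r : ℝ} (h0 : 0 ≤ r) (h1 : r < 1) :
    Summable (fun m : ℤ => r ^ m.natAbs) := by
  apply Summable.of_nat_of_neg
  · simpa using summable_geometric_of_lt_one h0 h1
  · simpa using summable_geometric_of_lt_one h0 h1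

lemma summable_real {f : ℤ → ℕ} (hf : ∀ m, m.natAbs ≤ f m + 1) {r : ℝ} (h0 : 0 < r)
    (h1 : r < 1) : Summable (fun m : ℤ => r ^ f m) := by
  refine Summable.of_nonneg_of_le (fun m => by positivity) (fun m => ?_)
    ((summable_natAbs h0.le h1).mul_left r⁻¹)
  rw [le_inv_mul_iff₀ h0, ← pow_succ']
  exact pow_le_pow_of_le_one h0.le h1.le (hf m)

lemma summable_norm' {f : ℤ → ℕ} (hf : ∀ m, m.natAbs ≤ f m + 1) {q : ℂ} (h : ‖q‖ < 1) :
    Summable (fun m : ℤ => ‖q ^ f m‖) := by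
  obtain ⟨r, hr, hr1⟩ := exists_between h
  refine Summable.of_nonneg_of_le (fun m => by positivity) (fun m => ?_)
    (summable_real hf (lt_of_le_of_lt (norm_nonneg q) hr) hr1)
  rw [norm_pow]
  exact pow_le_pow_left₀ (norm_nonneg q) hr.le _

lemma T_diff {f : ℤ → ℕ} (hf : ∀ m, m.natAbs ≤ f m + 1) :
    DifferentiableOn ℂ (T f) (Metric.ball 0 1) := by
  intro q hq
  have h : ‖q‖ < 1 := by simpa using hq
  obtain ⟨r, hr, hr1⟩ := exists_between h
  have key : DifferentiableOn ℂ (T f) (Metric.ball 0 r) := by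
    refine Complex.differentiableOn_tsum_of_summable_norm
      (summable_real hf (lt_of_le_of_lt (norm_nonneg q) hr) hr1)
      (fun m => by fun_prop) Metric.isOpen_ball (fun m w hw => ?_)
    rw [norm_pow]
    exact pow_le_pow_left₀ (norm_nonneg w) (show ‖w‖ < r by simpa using hw).le _
  exact (key.differentiableAt (Metric.isOpen_ball.mem_nhds (by simpa using hr))).differentiableWithinAt

abbrev P : ℂ → ℂ := T f3
abbrev S : ℂ → ℂ := T f2

lemma P_zero : P 0 = 1 := by
  unfold P T
  rw [tsum_eq_single 0]
  · simp [f3]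
  · intro m hm
    apply zero_pow
    have := f3_cast m
    have : 0 < m ^ 2 := by positivity
    omega

lemma S_zero : S 0 = 2 := by
  unfold S T
  rw [tsum_eq_sum (s := {0, -1})]
  · simp [f2]; norm_num
  · intro m hm
    simp at hm
    apply zero_pow
    have := f2_cast m
    have : m ^ 2 + m ≠ 0 := by
      intro h
      have : m * (m + 1) = 0 := by linarith
      rcases mul_eq_zero.mp this with h | h
      · exact hm.1 h
      · exact hm.2 (by omega)
    omega

/-- parity splitting of the lattice -/
def e0 : (ℤ × ℤ) ⊕ (ℤ × ℤ) → ℤ × ℤ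
  | Sum.inl p => (p.1 + p.2, p.1 - p.2)
  | Sum.inr p => (p.1 + p.2 + 1, p.1 - p.2)

lemma e0_bij : Function.Bijective e0 := by
  constructor
  · rintro (⟨a, b⟩ | ⟨a, b⟩) (⟨c, d⟩ | ⟨c, d⟩) h <;> simp [e0] at h ⊢ <;> omega
  · rintro ⟨n, m⟩
    rcases Int.even_or_odd' (n + m) with ⟨k, hk | hk⟩
    · exact ⟨Sum.inl (k, n - k), by simp [e0]; omega⟩
    · exact ⟨Sum.inr (k, n - k - 1), by simp [e0]; omega⟩

lemma T_mul {f g : ℤ → ℕ} (hf : ∀ m, m.natAbs ≤ f m + 1) (hg : ∀ m, m.natAbs ≤ g m + 1)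
    {q : ℂ} (h : ‖q‖ < 1) :
    Summable (fun z : ℤ × ℤ => q ^ f z.1 * q ^ g z.2) ∧
    T f q * T g q = ∑' z : ℤ × ℤ, q ^ f z.1 * q ^ g z.2 := by
  have h1 := summable_norm' hf h
  have h2 := summable_norm' hg h
  constructor
  · exact summable_mul_of_summable_norm (f := fun m => q ^ f m) (g := fun m => q ^ g m) h1 h2
  · unfold T
    exact tsum_mul_tsum_of_summable_norm (f := fun m => q ^ f m) (g := fun m => q ^ g m) h1 h2

lemma T_sq {f : ℤ → ℕ} (hf : ∀ m, m.natAbs ≤ f m + 1) {q : ℂ} (h : ‖q‖ < 1) :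
    T f q ^ 2 = (∑' z : ℤ × ℤ, q ^ (f (z.1 + z.2) + f (z.1 - z.2)))
      + ∑' z : ℤ × ℤ, q ^ (f (z.1 + z.2 + 1) + f (z.1 - z.2)) := by
  obtain ⟨hs, he⟩ := T_mul hf hf h
  rw [sq, he, ← (Equiv.ofBijective e0 e0_bij).tsum_eq]
  have hs' := (Equiv.ofBijective e0 e0_bij).summable_iff.mpr hs
  rw [Summable.tsum_sum (f := fun x => q ^ f ((Equiv.ofBijective e0 e0_bij) x).1 *
    q ^ f ((Equiv.ofBijective e0 e0_bij) x).2)]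
  · simp [e0, pow_add]
  · exact hs'.comp_injective Sum.inl_injective
  · exact hs'.comp_injective Sum.inr_injective

lemma norm_sq_lt {q : ℂ} (h : ‖q‖ < 1) : ‖q ^ 2‖ < 1 := by
  rw [norm_pow]; exact pow_lt_one₀ (norm_nonneg q) h (by norm_num)

lemma P_sq {q : ℂ} (h : ‖q‖ < 1) : P q ^ 2 = P (q ^ 2) ^ 2 + q * S (q ^ 2) ^ 2 := by
  have h2 := norm_sq_lt h
  rw [T_sq f3_ge h, sq (P (q^2)), sq (S (q^2)), (T_mul f3_ge f3_ge h2).2,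
    (T_mul f2_ge f2_ge h2).2, ← tsum_mul_left]
  congr 1
  · refine tsum_congr fun z => ?_
    rw [← pow_add, ← pow_mul]
    congr 1
    zify
    simp only [f3_cast]; ring
  · refine tsum_congr fun z => ?_
    rw [← pow_add, ← pow_mul, ← pow_succ']
    congr 1
    zify
    simp only [f3_cast, f2_cast]; ring

lemma S_sq {q : ℂ} (h : ‖q‖ < 1) : S q ^ 2 = 2 * P (q ^ 2) * S (q ^ 2) := by
  have h2 := norm_sq_lt h
  have e1 : (∑' z : ℤ × ℤ, q ^ (f2 (z.1 + z.2) + f2 (z.1 - z.2))) = S (q ^ 2) * P (q ^ 2) := by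
    rw [(T_mul f2_ge f3_ge h2).2]
    refine tsum_congr fun z => ?_
    rw [← pow_add, ← pow_mul]
    congr 1
    zify
    simp only [f3_cast, f2_cast]; ring
  have e2 : (∑' z : ℤ × ℤ, q ^ (f2 (z.1 + z.2 + 1) + f2 (z.1 - z.2)))
      = P (q ^ 2) * S (q ^ 2) := by
    rw [(T_mul f3_ge f2_ge h2).2, ← ((Equiv.addRight (1 : ℤ)).prodCongr (Equiv.refl ℤ)).tsum_eq
      (fun z : ℤ × ℤ => (q ^ 2) ^ f3 z.1 * (q ^ 2) ^ f2 z.2)]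
    refine tsum_congr fun z => ?_
    rw [← pow_add, ← pow_mul]
    congr 1
    zify
    simp only [f3_cast, f2_cast, Equiv.prodCongr_apply, Prod.map, Equiv.coe_addRight,
      Equiv.refl_apply]
    ring
  rw [T_sq f2_ge h, e1, e2]; ring

/-- `N q = P (-q)` -/
def N (q : ℂ) : ℂ := P (-q)

lemma N_sq {q : ℂ} (h : ‖q‖ < 1) : N q ^ 2 = P (q ^ 2) ^ 2 - q * S (q ^ 2) ^ 2 := by
  have := P_sq (q := -q) (by simpa using h)
  rw [neg_sq] at this
  rw [N, this]; ring

lemma jac {q : ℂ} (h : ‖q‖ < 1) : P q ^ 4 = q * S q ^ 4 + N q ^ 4 := by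
  linear_combination (P q ^ 2 + P (q ^ 2) ^ 2 + q * S (q ^ 2) ^ 2) * P_sq h
    - (N q ^ 2 + P (q ^ 2) ^ 2 - q * S (q ^ 2) ^ 2) * N_sq h
    - q * (S q ^ 2 + 2 * P (q ^ 2) * S (q ^ 2)) * S_sq h

lemma PN {q : ℂ} (h : ‖q‖ < 1) : P q ^ 2 * N q ^ 2 = N (q ^ 2) ^ 4 := by
  rw [P_sq h, N_sq h]
  linear_combination jac (norm_sq_lt h)

lemma diffP {q : ℂ} (h : ‖q‖ < 1) : DifferentiableAt ℂ P q :=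
  (T_diff f3_ge).differentiableAt (Metric.isOpen_ball.mem_nhds (by simpa using h))

lemma diffS {q : ℂ} (h : ‖q‖ < 1) : DifferentiableAt ℂ S q :=
  (T_diff f2_ge).differentiableAt (Metric.isOpen_ball.mem_nhds (by simpa using h))

lemma diffN {q : ℂ} (h : ‖q‖ < 1) : DifferentiableAt ℂ N q := by
  have := diffP (q := -q) (by simpa using h)
  exact this.comp q (by fun_prop)

lemma N_zero : N 0 = 1 := by simp [N, P_zero]

lemma tends {q : ℂ} (h : ‖q‖ < 1) : Tendsto (fun n : ℕ => q ^ (2 ^ n)) atTop (𝓝 0) :=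
  (tendsto_pow_atTop_nhds_zero_of_norm_lt_one h).comp
    (tendsto_pow_atTop_atTop_of_one_lt (by norm_num))

lemma norm_it {q : ℂ} (h : ‖q‖ < 1) (n : ℕ) : ‖q ^ (2 ^ n)‖ < 1 := by
  rw [norm_pow]; exact pow_lt_one₀ (norm_nonneg q) h (by positivity)

/-- descent: a property true near zero and inherited from `q^2` to `q` is true on the disc -/
lemma descent {p : ℂ → Prop} (h0 : ∀ᶠ q in 𝓝 0, p q)
    (hd : ∀ q, ‖q‖ < 1 → p (q ^ 2) → p q) {q : ℂ} (h : ‖q‖ < 1) : p q := by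
  obtain ⟨n, hn⟩ := ((tends h).eventually h0).exists
  induction n with
  | zero => simpa using hn
  | succ n ih =>
    apply ih
    apply hd _ (norm_it h n)
    rwa [← pow_mul, ← pow_succ]

lemma N_ne {q : ℂ} (h : ‖q‖ < 1) : N q ≠ 0 := by
  refine descent (p := fun q => N q ≠ 0) ?_ ?_ h
  · apply (diffN (by simp)).continuousAt.eventually_ne
    rw [N_zero]; norm_num
  · intro q h hn h0
    have := PN h
    rw [h0] at this
    apply hn
    simpa using this.symm

lemma P_ne {q : ℂ} (h : ‖q‖ < 1) : P q ≠ 0 := by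
  have := N_ne (q := -q) (by simpa using h)
  simpa [N] using this

lemma S_ne {q : ℂ} (h : ‖q‖ < 1) : S q ≠ 0 := by
  refine descent (p := fun q => S q ≠ 0) ?_ ?_ h
  · apply (diffS (by simp)).continuousAt.eventually_ne
    rw [S_zero]; norm_num
  · intro q h hn h0
    have := S_sq h
    rw [h0] at this
    have hp := P_ne (norm_sq_lt h)
    simp at this
    tauto

lemma ev {q : ℂ} (h : ‖q‖ < 1) : ∀ᶠ w in 𝓝 q, ‖w‖ < 1 :=
  continuous_norm.continuousAt.eventually_lt continuousAt_const h

lemma analytic {f : ℂ → ℂ} (hf : ∀ q : ℂ, ‖q‖ < 1 → DifferentiableAt ℂ f q) {q : ℂ}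
    (h : ‖q‖ < 1) : DifferentiableAt ℂ (deriv f) q := by
  have : DifferentiableOn ℂ f (Metric.ball 0 1) := fun w hw =>
    (hf w (by simpa using hw)).differentiableWithinAt
  exact (this.deriv Metric.isOpen_ball).differentiableAt
    (Metric.isOpen_ball.mem_nhds (by simpa using h))

lemma hd_sq {f : ℂ → ℂ} {q : ℂ} (hf : DifferentiableAt ℂ f (q ^ 2)) :
    HasDerivAt (fun w => f (w ^ 2)) (deriv f (q ^ 2) * (2 * q)) q := by
  have h1 : HasDerivAt (fun w : ℂ => w ^ 2) (2 * q) q := by simpa using hasDerivAt_pow 2 q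
  exact HasDerivAt.comp q hf.hasDerivAt h1

lemma dP {q : ℂ} (h : ‖q‖ < 1) : 2 * P q * deriv P q =
    2 * P (q ^ 2) * (deriv P (q ^ 2) * (2 * q)) + (S (q ^ 2) ^ 2 +
      q * (2 * S (q ^ 2) * (deriv S (q ^ 2) * (2 * q)))) := by
  have h2 := norm_sq_lt h
  have l := (diffP h).hasDerivAt.pow 2
  have r := ((hd_sq (diffP h2)).pow 2).add ((hasDerivAt_id q).mul ((hd_sq (diffS h2)).pow 2))
  have := l.unique (r.congr_of_eventuallyEq ((ev h).mono fun w hw => P_sq hw))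
  simpa using this

lemma dS {q : ℂ} (h : ‖q‖ < 1) : 2 * S q * deriv S q =
    2 * (deriv P (q ^ 2) * (2 * q)) * S (q ^ 2) + 2 * P (q ^ 2) * (deriv S (q ^ 2) * (2 * q)) := by
  have h2 := norm_sq_lt h
  have l := (diffS h).hasDerivAt.pow 2
  have r := ((hd_sq (diffP h2)).const_mul 2).mul (hd_sq (diffS h2))
  have := l.unique (r.congr_of_eventuallyEq ((ev h).mono fun w hw => S_sq hw))
  simpa using this

/-- `E` as a function of `q` -/
def E (q : ℂ) : ℂ := 1 + 4 * (q * deriv S q) / S q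

lemma diffE {q : ℂ} (h : ‖q‖ < 1) : DifferentiableAt ℂ E q := by
  have h1 := diffS h
  have h2 := analytic (f := S) (fun q h => diffS h) h
  have h3 := S_ne h
  unfold E
  fun_prop (disch := assumption)

def R (q : ℂ) : ℂ := (E q - 4 * (q * deriv P q) / P q) / N q ^ 4

lemma diffR {q : ℂ} (h : ‖q‖ < 1) : DifferentiableAt ℂ R q := by
  have h1 := diffE h
  have h2 := analytic (f := P) (fun q h => diffP h) h
  have h3 := P_ne h
  have h4 := diffN h
  have h5 : N q ^ 4 ≠ 0 := pow_ne_zero _ (N_ne h)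
  have h6 := diffP h
  unfold R
  fun_prop (disch := assumption)

lemma R_sq {q : ℂ} (h : ‖q‖ < 1) : R q = R (q ^ 2) := by
  have h2 := norm_sq_lt h
  have p0 := P_ne h
  have s0 := S_ne h
  have n0 := N_ne h
  have a0 := P_ne h2
  have b0 := S_ne h2
  have c0 := N_ne h2
  have e1 := P_sq h
  have e2 := S_sq h
  have e3 := N_sq h
  have e4 := PN h
  have e5 := dP h
  have e6 := dS h
  unfold R E
  have t1 : q * deriv S q / S q = q ^ 2 * deriv P (q ^ 2) / P (q ^ 2)
      + q ^ 2 * deriv S (q ^ 2) / S (q ^ 2) := by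
    have : q * deriv S q / S q = q * (2 * S q * deriv S q) / (2 * S q ^ 2) := by
      field_simp
    rw [this, e6, e2]
    field_simp
  have t2 : q * deriv P q / P q = (q * (2 * P q * deriv P q)) / (2 * P q ^ 2) := by
      field_simp
  have pp : P (q ^ 2) ^ 2 + q * S (q ^ 2) ^ 2 ≠ 0 := e1 ▸ pow_ne_zero 2 p0
  have nn : P (q ^ 2) ^ 2 - q * S (q ^ 2) ^ 2 ≠ 0 := e3 ▸ pow_ne_zero 2 n0
  have hN : N q ^ 4 = (P (q ^ 2) ^ 2 - q * S (q ^ 2) ^ 2) ^ 2 := by rw [← e3]; ring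
  rw [mul_div_assoc 4 (q * deriv S q), t1, mul_div_assoc 4 (q * deriv P q), t2, e5, e1, hN, ← e4, e1, e3]
  field_simp
  ring

lemma R_one {q : ℂ} (h : ‖q‖ < 1) : R q = 1 := by
  have hn : ∀ n : ℕ, R (q ^ (2 ^ n)) = R q := by
    intro n
    induction n with
    | zero => simp
    | succ n ih => rw [← ih, R_sq (norm_it h n), ← pow_mul, ← pow_succ]
  have h0 : R 0 = 1 := by simp [R, E, N_zero]
  have t := ((diffR (q := 0) (by simp)).continuousAt.tendsto).comp (tends h)
  rw [h0] at t
  refine tendsto_nhds_unique ?_ t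
  simp only [Function.comp_def, hn]
  exact tendsto_const_nhds

lemma odeS {q : ℂ} (h : ‖q‖ < 1) : 4 * (q * deriv S q) = (E q - 1) * S q := by
  have := S_ne h
  unfold E
  field_simp
  ring

lemma odeP {q : ℂ} (h : ‖q‖ < 1) : 4 * (q * deriv P q) = (E q - N q ^ 4) * P q := by
  have h1 := R_one h
  have := P_ne h
  have := N_ne h
  unfold R at h1
  field_simp at h1
  linear_combination -h1

lemma odeN {q : ℂ} (h : ‖q‖ < 1) : 4 * (q * deriv N q) = (E q - P q ^ 4) * N q := by
  have l := (diffP h).hasDerivAt.pow 4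
  have r := ((hasDerivAt_id q).mul ((diffS h).hasDerivAt.pow 4)).add ((diffN h).hasDerivAt.pow 4)
  have e := l.unique (r.congr_of_eventuallyEq ((ev h).mono fun w hw => jac hw))
  simp at e
  have n0 := pow_ne_zero 3 (N_ne h)
  apply mul_left_cancel₀ n0
  linear_combination (-q) * e + P q ^ 3 * odeP h - q * S q ^ 3 * odeS h + E q * jac h

lemma E_sq {q : ℂ} (h : ‖q‖ < 1) : E q = 2 * E (q ^ 2) - N (q ^ 2) ^ 4 := by
  have h2 := norm_sq_lt h
  have s0 := pow_ne_zero 2 (S_ne h)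
  have a0 := P_ne h2
  have b0 := S_ne h2
  apply mul_left_cancel₀ s0
  linear_combination (-S q) * odeS h + 2 * q * dS h + 2 * S (q ^ 2) * odeP h2
     + 2 * P (q ^ 2) * odeS h2 + (1 - 2 * E (q ^ 2) + N (q ^ 2) ^ 4) * S_sq h

def G (q : ℂ) : ℂ := 2 * (q * deriv E q) - E q ^ 2 + P q ^ 4 * N q ^ 4

lemma G_sq {q : ℂ} (h : ‖q‖ < 1) : G q = 4 * G (q ^ 2) := by
  have h2 := norm_sq_lt h
  have l := (diffE h).hasDerivAt
  have r := ((hd_sq (diffE h2)).const_mul 2).sub ((hd_sq (diffN h2)).pow 4)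
  have e := l.unique (r.congr_of_eventuallyEq ((ev h).mono fun w hw => E_sq hw))
  simp at e
  have e4 : P q ^ 4 * N q ^ 4 = N (q ^ 2) ^ 8 := by
    linear_combination (P q ^ 2 * N q ^ 2 + N (q ^ 2) ^ 4) * PN h
  unfold G
  rw [e4, E_sq h, e]
  linear_combination (-4) * N (q ^ 2) ^ 3 * odeN h2

lemma diffG {q : ℂ} (h : ‖q‖ < 1) : DifferentiableAt ℂ G q := by
  have h1 := diffE h
  have h2 := analytic (f := E) (fun q h => diffE h) h
  have h4 := diffN h
  have h6 := diffP h
  unfold G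
  fun_prop

lemma G_zero' {q : ℂ} (h : ‖q‖ < 1) : G q = 0 := by
  have hn : ∀ n : ℕ, G q = 4 ^ n * G (q ^ (2 ^ n)) := by
    intro n
    induction n with
    | zero => simp
    | succ n ih => rw [ih, G_sq (norm_it h n), ← pow_mul, ← pow_succ]; ring
  have h0 : G 0 = 0 := by simp [G, E, N_zero, P_zero]
  have hO := (diffG (q := 0) (by simp)).isBigO_sub
  simp only [h0, sub_zero] at hO
  have hO2 := (hO.comp_tendsto (tends h))
  have hO3 := (Asymptotics.isBigO_refl (fun n : ℕ => (4 : ℂ) ^ n) atTop).mul hO2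
  have t : Tendsto (fun n : ℕ => (4 : ℂ) ^ n * q ^ (2 ^ n)) atTop (𝓝 0) := by
    rw [tendsto_zero_iff_norm_tendsto_zero]
    have := (tendsto_pow_const_mul_const_pow_of_abs_lt_one 2 (r := ‖q‖) (by simpa using h)).comp
      (tendsto_pow_atTop_atTop_of_one_lt (r := (2 : ℕ)) (by norm_num))
    refine this.congr fun n => ?_
    simp [← pow_mul]
    left
    rw [mul_comm, pow_mul]; norm_num
  have t2 := hO3.trans_tendsto t
  refine tendsto_nhds_unique ?_ t2
  simp only [Function.comp_def, ← hn]
  exact tendsto_const_nhds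

end ThetaAux

namespace ThetaAux

open Filter Topology

def Q (τ : ℂ) : ℂ := Complex.exp (2 * Real.pi * Complex.I * τ)
def Q4 (τ : ℂ) : ℂ := Complex.exp (2 * Real.pi * Complex.I * τ / 4)

lemma Q4_pow (τ : ℂ) : Q4 τ ^ 4 = Q τ := by
  rw [Q4, Q, ← Complex.exp_nat_mul]; congr 1; push_cast; ring

lemma Q4_ne (τ : ℂ) : Q4 τ ≠ 0 := Complex.exp_ne_zero _

lemma Q_norm {τ : ℂ} (h : 0 < τ.im) : ‖Q τ‖ < 1 := by
  rw [Q, Complex.norm_exp]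
  simp
  positivity

lemma exp_Q (τ : ℂ) (n : ℕ) : Complex.exp (2 * Real.pi * Complex.I * τ * n) = Q τ ^ n := by
  rw [Q, ← Complex.exp_nat_mul]; congr 1; ring

lemma f3_castC (m : ℤ) : (f3 m : ℂ) = (m : ℂ) ^ 2 := by exact_mod_cast f3_cast m
lemma f2_castC (m : ℤ) : (f2 m : ℂ) = (m : ℂ) ^ 2 + m := by exact_mod_cast f2_cast m

lemma th3 : theta3 = fun τ => P (Q τ) := by
  ext τ
  refine tsum_congr fun m => ?_
  rw [← f3_castC, exp_Q]

lemma th4 : theta4 = fun τ => N (Q τ) := by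
  ext τ
  refine tsum_congr fun m => ?_
  rw [← f3_castC, exp_Q, neg_pow (Q τ)]
  congr 1
  rw [← zpow_natCast, f3_cast]
  rcases Int.even_or_odd m with hm | hm
  · rw [hm.neg_one_zpow, (hm.pow_of_ne_zero two_ne_zero).neg_one_zpow]
  · rw [hm.neg_one_zpow, hm.pow.neg_one_zpow]

lemma th2 : theta2 = fun τ => Q4 τ * S (Q τ) := by
  ext τ
  simp only [S, T]
  rw [← tsum_mul_left]
  refine tsum_congr fun m => ?_
  rw [← exp_Q, Q4, ← Complex.exp_add, f2_castC]
  congr 1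
  ring

lemma hdQ (τ : ℂ) : HasDerivAt Q (2 * Real.pi * Complex.I * Q τ) τ := by
  have := ((hasDerivAt_id τ).const_mul (2 * Real.pi * Complex.I)).cexp
  refine this.congr_deriv ?_
  simp [Q, mul_comm]

lemma hdQ4 (τ : ℂ) : HasDerivAt Q4 (2 * Real.pi * Complex.I / 4 * Q4 τ) τ := by
  have := (((hasDerivAt_id τ).const_mul (2 * Real.pi * Complex.I)).div_const 4).cexp
  refine this.congr_deriv ?_
  simp [Q4, mul_comm]

lemma hd_comp {f : ℂ → ℂ} {τ : ℂ} (hf : DifferentiableAt ℂ f (Q τ)) :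
    HasDerivAt (fun t => f (Q t)) (deriv f (Q τ) * (2 * Real.pi * Complex.I * Q τ)) τ :=
  HasDerivAt.comp τ hf.hasDerivAt (hdQ τ)

lemma pi_ne : (2 * Real.pi * Complex.I : ℂ) ≠ 0 := Complex.two_pi_I_ne_zero

lemma dq_comp {f : ℂ → ℂ} {τ : ℂ} (hf : DifferentiableAt ℂ f (Q τ)) :
    dq (fun t => f (Q t)) τ = Q τ * deriv f (Q τ) := by
  rw [dq, (hd_comp hf).deriv, inv_mul_eq_iff_eq_mul₀ pi_ne]
  ring

lemma hd_th2 {τ : ℂ} (h : 0 < τ.im) :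
    HasDerivAt theta2 (2 * Real.pi * Complex.I / 4 * (E (Q τ) * theta2 τ)) τ := by
  have := (hdQ4 τ).mul (hd_comp (diffS (Q_norm h)))
  rw [th2]
  refine this.congr_deriv ?_
  linear_combination (2 * Real.pi * Complex.I / 4 * Q4 τ) * odeS (Q_norm h)

lemma th2_ne {τ : ℂ} (h : 0 < τ.im) : theta2 τ ≠ 0 := by
  rw [th2]; exact mul_ne_zero (Q4_ne τ) (S_ne (Q_norm h))

lemma E2_eq {τ : ℂ} (h : 0 < τ.im) : E2sig τ = E (Q τ) := by
  have h1 := (hd_th2 h).pow 4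
  have h0 := th2_ne h
  have hp := pi_ne
  have : deriv (fun t => theta2 t ^ 4) τ = _ := h1.deriv
  rw [E2sig, dq, this, div_eq_iff (pow_ne_zero 4 h0), inv_mul_eq_iff_eq_mul₀ hp]
  push_cast
  ring

end ThetaAux

open ThetaAux in
theorem jacobi_theta_quartic_identity_and_system (τ : ℂ) (hτ : 0 < τ.im) :
    theta3 τ ^ 4 = theta2 τ ^ 4 + theta4 τ ^ 4 ∧
    4 * dq theta2 τ = E2sig τ * theta2 τ ∧
    4 * dq theta3 τ = (E2sig τ - theta4 τ ^ 4) * theta3 τ ∧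
    4 * dq theta4 τ = (E2sig τ - theta3 τ ^ 4) * theta4 τ ∧
    2 * dq E2sig τ = E2sig τ ^ 2 - theta3 τ ^ 4 * theta4 τ ^ 4 := by
  have hq := Q_norm hτ
  have hE : dq E2sig τ = Q τ * deriv E (Q τ) := by
    rw [← dq_comp (diffE hq), dq, dq]
    congr 1
    apply Filter.EventuallyEq.deriv_eq
    filter_upwards [(isOpen_lt continuous_const Complex.continuous_im).mem_nhds hτ] with t ht
    exact E2_eq ht
  refine ⟨?_, ?_, ?_, ?_, ?_⟩
  · rw [th3, th4, th2]
    simp only [mul_pow, Q4_pow]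
    exact jac hq
  · rw [dq, (hd_th2 hτ).deriv, E2_eq hτ]
    have := pi_ne
    field_simp
  · rw [E2_eq hτ, th3, th4, dq_comp (diffP hq)]
    exact odeP hq
  · rw [E2_eq hτ, th3, th4, dq_comp (diffN hq)]
    exact odeN hq
  · rw [hE, E2_eq hτ, th3, th4]
    have := G_zero' hq
    unfold G at this
    linear_combination this
end
end

section
/- The signature-3 (Borwein) forms satisfy the cubic identity and a coupled system of nonlinear first-order differential equations: for all τ in the upper half-plane, 𝒜₃³ = ℬ₃³ + 𝒞₃³, and, setting ℰ₃ := (𝒞₃³)′/𝒞₃³, one has (𝒜₃³)′ = ℰ₃·𝒜₃³ − 𝒜₃²·ℬ₃³, (ℬ₃³)′ = ℰ₃·ℬ₃³ − 𝒜₃²·ℬ₃³, and 3·ℰ₃′ = ℰ₃² − 𝒜₃·ℬ₃³. -/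
open Complex

noncomputable section

/-- q = exp(2πiτ). -/
def qq (τ : ℂ) : ℂ := Complex.exp (2 * Real.pi * Complex.I * τ)

/-- The Dedekind eta function η(τ) = exp(πiτ/12)·∏_{n≥1} (1 − qⁿ). -/
def dedekindEta (τ : ℂ) : ℂ :=
  Complex.exp (Real.pi * Complex.I * τ / 12) * ∏' n : ℕ, (1 - qq τ ^ (n + 1))

/-- The Borwein cubic theta function 𝒜₃(τ) = ∑_{n,m∈ℤ} q^{n²+nm+m²}. -/
def A3 (τ : ℂ) : ℂ := ∑' p : ℤ × ℤ, qq τ ^ (p.1 ^ 2 + p.1 * p.2 + p.2 ^ 2)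

/-- ℬ₃(τ) = η(τ)³/η(3τ). -/
def B3 (τ : ℂ) : ℂ := dedekindEta τ ^ 3 / dedekindEta (3 * τ)

/-- 𝒞₃(τ) = 3·η(3τ)³/η(τ). -/
def C3 (τ : ℂ) : ℂ := 3 * dedekindEta (3 * τ) ^ 3 / dedekindEta τ

/-- ℰ₃ := (𝒞₃³)′/𝒞₃³. -/
def E3sig : ℂ → ℂ := fun τ => dq (fun t => C3 t ^ 3) τ / C3 τ ^ 3


open UpperHalfPlane (denom ofComplex_apply_of_im_pos) in
open scoped ModularForm MatrixGroups UpperHalfPlane in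
lemma levelOne_aux (n : ℂ → ℂ) (k : ℤ) (hk : k < 0)
    (hol : DifferentiableOn ℂ n {z | 0 < z.im})
    (hT : ∀ τ : ℂ, 0 < τ.im → n (τ + 1) = n τ)
    (hS : ∀ τ : ℂ, 0 < τ.im → n (-1 / τ) = τ ^ k * n τ)
    (hb : ∃ C Y : ℝ, ∀ τ : ℂ, Y ≤ τ.im → ‖n τ‖ ≤ C) :
    ∀ τ : ℂ, 0 < τ.im → n τ = 0 := by
  let g : ℍ → ℂ := fun z => n z
  have gS : g ∣[k] ModularGroup.S = g := by
    ext z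
    rw [ModularForm.SL_slash_apply, UpperHalfPlane.modular_S_smul, ModularGroup.denom_S]
    have h := hS z z.2
    have hz : (z : ℂ) ≠ 0 := z.ne_zero
    have e : (((-(z : ℂ))⁻¹ : ℂ)) = -1 / (z : ℂ) := by field_simp
    change n ((-(z : ℂ))⁻¹) * _ = n z
    rw [e, h, zpow_neg]
    field_simp
  have gT : g ∣[k] ModularGroup.T = g := by
    ext z
    rw [ModularForm.SL_slash_apply, UpperHalfPlane.modular_T_smul, ModularGroup.denom_apply]
    have h := hT z z.2
    have e : ((((1 : ℝ) +ᵥ z : ℍ) : ℂ)) = z + 1 := by simp [add_comm]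
    change n (((1 : ℝ) +ᵥ z : ℍ) : ℂ) * _ = n z
    rw [e, h]
    simp [ModularGroup.T]
  have gG := SlashInvariantForm.slash_action_generators_SL2Z gS gT
  let F : ModularForm 𝒮ℒ k :=
    { toFun := g
      slash_action_eq' := fun A hA => by
        obtain ⟨A, rfl⟩ := hA
        exact gG A
      holo' := by
        rw [UpperHalfPlane.mdifferentiable_iff]
        refine hol.congr fun z hz => ?_
        simp [g, ofComplex_apply_of_im_pos hz]
      bdd_at_cusps' := fun {c} hc => by
        rw [Subgroup.IsArithmetic.isCusp_iff_isCusp_SL2Z] at hc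
        rw [OnePoint.isBoundedAt_iff_forall_SL2Z hc]
        intro γ _
        rw [gG γ, UpperHalfPlane.isBoundedAtImInfty_iff]
        obtain ⟨C, Y, h⟩ := hb
        exact ⟨C, Y, fun z hz => h z hz⟩ }
  have := ModularFormClass.levelOne_neg_weight_eq_zero hk F
  intro τ hτ
  exact congrFun this ⟨τ, hτ⟩

lemma neg_inv_im {τ : ℂ} (hτ : 0 < τ.im) : 0 < (-1 / τ).im := by
  have h : τ ≠ 0 := by rintro rfl; simp at hτ
  rw [show -1 / τ = -τ⁻¹ by field_simp, Complex.neg_im, Complex.inv_im, neg_div, neg_neg]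
  exact div_pos hτ (Complex.normSq_pos.mpr h)

lemma mul_three_im {τ : ℂ} (hτ : 0 < τ.im) : 0 < (3 * τ).im := by
  simpa using hτ

lemma mobius_im {τ : ℂ} (hτ : 0 < τ.im) : 0 < (-1 / (3 * τ)).im := neg_inv_im (mul_three_im hτ)

lemma add_div_three_im {τ : ℂ} (hτ : 0 < τ.im) (j : ℝ) : 0 < ((τ + j) / 3).im := by
  rw [show (τ + j) / 3 = (1 / 3 : ℝ) * (τ + j) by push_cast; ring, Complex.im_ofReal_mul]
  simpa using hτ

lemma ne_zero_of_im {τ : ℂ} (hτ : 0 < τ.im) : τ ≠ 0 := by rintro rfl; simp at hτ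

/-- The filter of neighbourhoods of the cusp at infinity. -/
abbrev Iinf : Filter ℂ := Filter.comap Complex.im Filter.atTop

lemma Iinf_pos : ∀ᶠ z in Iinf, 0 < z.im :=
  Filter.tendsto_comap.eventually (Filter.eventually_gt_atTop 0)

/-- The infinite product in the eta function. -/
def uProd (τ : ℂ) : ℂ := ∏' n : ℕ, (1 - qq τ ^ (n + 1))

lemma dedekindEta_eq (τ : ℂ) : dedekindEta τ = Complex.exp (Real.pi * Complex.I * τ / 12) * uProd τ := rfl

lemma dedekindEta_eq_eta : dedekindEta = ModularForm.eta := by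
  funext τ
  unfold dedekindEta ModularForm.eta
  congr 1
  · rw [Function.Periodic.qParam]
    congr 1
    push_cast
    ring
  · refine tprod_congr fun n => ?_
    rw [ModularForm.eta_q_eq_pow, qq]

lemma qq_add_one (τ : ℂ) : qq (τ + 1) = qq τ := by
  unfold qq
  rw [mul_add, mul_one, Complex.exp_periodic]

lemma uProd_add_one (τ : ℂ) : uProd (τ + 1) = uProd τ := by
  simp only [uProd, qq_add_one]

lemma eta_add_one (τ : ℂ) :
    dedekindEta (τ + 1) = Complex.exp (Real.pi * Complex.I / 12) * dedekindEta τ := by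
  rw [dedekindEta_eq, dedekindEta_eq, uProd_add_one, ← mul_assoc, ← Complex.exp_add]
  congr 2
  ring

lemma eta_ne {τ : ℂ} (hτ : 0 < τ.im) : dedekindEta τ ≠ 0 := by
  rw [dedekindEta_eq_eta]; exact ModularForm.eta_ne_zero hτ

lemma eta_diff : DifferentiableOn ℂ dedekindEta {z | 0 < z.im} := by
  rw [dedekindEta_eq_eta]
  exact fun z hz => (ModularForm.differentiableAt_eta_of_mem_upperHalfPlaneSet hz).differentiableWithinAt

lemma eta_S {τ : ℂ} (hτ : 0 < τ.im) :
    dedekindEta (-1 / τ) = (Complex.sqrt I)⁻¹ * (Complex.sqrt τ * dedekindEta τ) := by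
  rw [dedekindEta_eq_eta]
  simpa using ModularForm.eta_comp_eq_csqrt_I_inv hτ

lemma eta_S_sq {τ : ℂ} (hτ : 0 < τ.im) :
    dedekindEta (-1 / τ) ^ 2 = -I * τ * dedekindEta τ ^ 2 := by
  rw [eta_S hτ, mul_pow, mul_pow, inv_pow]
  have h (z : ℂ) : Complex.sqrt z ^ 2 = z := by
    have := Complex.cpow_nat_inv_pow z (n := 2) two_ne_zero
    simpa [Complex.sqrt] using this
  rw [h, h, Complex.inv_I]
  ring

lemma tendsto_qq : Filter.Tendsto qq Iinf (nhds 0) := by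
  have := (Function.Periodic.qParam_tendsto (h := 1) one_pos).mono_right nhdsWithin_le_nhds
  refine this.congr fun τ => ?_
  simp [Function.Periodic.qParam, qq]

lemma tendsto_uProd : Filter.Tendsto uProd Iinf (nhds 1) := by
  have htprod : Filter.Tendsto (fun q : ℂ ↦ ∏' (n : ℕ), (1 - q ^ (n + 1))) (nhds 0) (nhds 1) := by
    have := tendsto_tprod_one_add_of_dominated_convergence (𝓕 := nhds 0) (g := 0)
      (f := fun (q : ℂ) (n : ℕ) ↦ -q ^ (n + 1)) (bound := fun n ↦ (1 / 2 : ℝ) ^ (n + 1))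
    simp only [Pi.zero_apply, norm_neg, norm_pow, add_zero, tprod_one] at this
    simp_rw [sub_eq_add_neg]
    refine this
      (by simpa only [pow_succ'] using (summable_geometric_of_abs_lt_one (by norm_num)).mul_left _)
      (fun k ↦ by simpa using ((continuous_pow (M := ℂ) (k + 1)).tendsto 0).neg) ?_
    filter_upwards [Metric.ball_mem_nhds (0 : ℂ) (by norm_num : (0 : ℝ) < 1 / 2)] with q hq k
    exact pow_le_pow_left₀ (norm_nonneg _) (mem_ball_zero_iff.mp hq).le _
  exact htprod.comp tendsto_qq


lemma isOpen_H : IsOpen {z : ℂ | 0 < z.im} := isOpen_lt continuous_const Complex.continuous_im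

lemma preconn_H : IsPreconnected {z : ℂ | 0 < z.im} := (convex_halfSpace_im_gt 0).isPreconnected

lemma analytic_H {f : ℂ → ℂ} (hf : DifferentiableOn ℂ f {z | 0 < z.im}) :
    AnalyticOnNhd ℂ f {z | 0 < z.im} := hf.analyticOnNhd isOpen_H

lemma mul_zero_H {f g : ℂ → ℂ} (hf : DifferentiableOn ℂ f {z | 0 < z.im})
    (hg : DifferentiableOn ℂ g {z | 0 < z.im}) (h : ∀ τ : ℂ, 0 < τ.im → f τ * g τ = 0) :
    (∀ τ : ℂ, 0 < τ.im → f τ = 0) ∨ (∀ τ : ℂ, 0 < τ.im → g τ = 0) :=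
  AnalyticOnNhd.eq_zero_or_eq_zero_of_mul_eq_zero (analytic_H hf) (analytic_H hg) h preconn_H

lemma decay_H {f : ℂ → ℂ} (hol : DifferentiableOn ℂ f {z | 0 < z.im})
    (hper : ∀ τ : ℂ, 0 < τ.im → f (τ + 1) = f τ)
    (hlim : Filter.Tendsto f Iinf (nhds 0)) :
    f =O[Iinf] fun z => Real.exp (-2 * Real.pi * z.im) := by
  classical
  let g : ℂ → ℂ := fun z => if 0 < z.im then f z else 0
  have hfg : g =ᶠ[Iinf] f := by
    filter_upwards [Iinf_pos] with z hz
    simp [g, hz]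
  have gper : Function.Periodic g (1 : ℝ) := by
    intro z
    by_cases hz : 0 < z.im
    · simp [g, hz, hper z hz]
    · simp [g, hz]
  have := Function.Periodic.exp_decay_of_zero_at_inf (f := g) (h := 1) one_pos gper (by
    filter_upwards [Iinf_pos] with z hz
    have h1 : DifferentiableAt ℂ f z := hol.differentiableAt (isOpen_H.mem_nhds hz)
    refine h1.congr_of_eventuallyEq ?_
    filter_upwards [isOpen_H.mem_nhds hz] with w hw
    have hw' : 0 < w.im := hw
    simp [g, hw']) (hlim.congr' hfg.symm)
  refine (this.congr' hfg ?_)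
  filter_upwards with z
  simp

lemma tendsto_div_three (j : ℝ) : Filter.Tendsto (fun z : ℂ => (z + j) / 3) Iinf Iinf := by
  rw [Filter.tendsto_comap_iff]
  have : (Complex.im ∘ fun z : ℂ => (z + j) / 3) = fun z => z.im / 3 := by
    funext z
    simp only [Function.comp]
    rw [show (z + j) / 3 = (1 / 3 : ℝ) * (z + j) by push_cast; ring, Complex.im_ofReal_mul]
    simp
    ring
  rw [this]
  exact Filter.tendsto_comap.atTop_div_const (by norm_num)

lemma decay_div {f : ℂ → ℂ} (h : f =O[Iinf] fun z => Real.exp (-2 * Real.pi * z.im)) (j : ℝ) :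
    (fun z : ℂ => f ((z + j) / 3)) =O[Iinf] fun z => Real.exp (-2 * Real.pi * z.im / 3) := by
  have := h.comp_tendsto (tendsto_div_three j)
  refine this.congr (fun _ => rfl) fun z => ?_
  simp only [Function.comp]
  rw [show (z + j) / 3 = (1 / 3 : ℝ) * (z + j) by push_cast; ring, Complex.im_ofReal_mul]
  simp
  ring

lemma diff_div {f : ℂ → ℂ} (hol : DifferentiableOn ℂ f {z | 0 < z.im}) (j : ℝ) :
    DifferentiableOn ℂ (fun z : ℂ => f ((z + j) / 3)) {z | 0 < z.im} := by
  refine hol.comp (f := fun z : ℂ => (z + j) / 3) (by fun_prop) ?_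
  intro z hz
  exact add_div_three_im hz j

/-- The norm down to level one. -/
def nrm (f : ℂ → ℂ) (τ : ℂ) : ℂ :=
  f τ * (f ((τ + (0 : ℝ)) / 3) * (f ((τ + (1 : ℝ)) / 3) * f ((τ + (2 : ℝ)) / 3)))

lemma nrm_diff {f : ℂ → ℂ} (hol : DifferentiableOn ℂ f {z | 0 < z.im}) :
    DifferentiableOn ℂ (nrm f) {z | 0 < z.im} :=
  hol.mul ((diff_div hol 0).mul ((diff_div hol 1).mul (diff_div hol 2)))

lemma nrm_T {f : ℂ → ℂ} (hper : ∀ τ : ℂ, 0 < τ.im → f (τ + 1) = f τ) {τ : ℂ} (hτ : 0 < τ.im) :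
    nrm f (τ + 1) = nrm f τ := by
  unfold nrm
  rw [hper τ hτ, show (τ + 1 + (0 : ℝ)) / 3 = (τ + (1 : ℝ)) / 3 by push_cast; ring,
    show (τ + 1 + (1 : ℝ)) / 3 = (τ + (2 : ℝ)) / 3 by push_cast; ring,
    show (τ + 1 + (2 : ℝ)) / 3 = (τ + (0 : ℝ)) / 3 + 1 by push_cast; ring,
    hper _ (add_div_three_im hτ 0)]
  ring

lemma nrm_S {f : ℂ → ℂ} {k : ℕ} {c : ℂ} (hc : c ^ 2 = (-3) ^ k)
    (hper : ∀ τ : ℂ, 0 < τ.im → f (τ + 1) = f τ)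
    (hW : ∀ τ : ℂ, 0 < τ.im → f (-1 / (3 * τ)) = c * τ ^ k * f τ) {τ : ℂ} (hτ : 0 < τ.im) :
    nrm f (-1 / τ) = τ ^ (4 * k) * nrm f τ := by
  have hτ0 := ne_zero_of_im hτ
  have h1 : f (-1 / τ) = c * (τ / 3) ^ k * f ((τ + (0 : ℝ)) / 3) := by
    have := hW ((τ + (0 : ℝ)) / 3) (add_div_three_im hτ 0)
    rw [show -1 / (3 * ((τ + (0 : ℝ)) / 3)) = -1 / τ by push_cast; field_simp; simp [hτ0]] at this
    rw [this]
    simp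
  have h2 : f ((-1 / τ + (0 : ℝ)) / 3) = c * τ ^ k * f τ := by
    rw [← hW τ hτ]
    congr 1
    push_cast
    field_simp
    simp
  have h3 : f ((-1 / τ + (1 : ℝ)) / 3) = τ ^ k * f ((τ + (2 : ℝ)) / 3) := by
    have hu : 0 < ((τ + (-1 : ℝ)) / 3).im := add_div_three_im hτ (-1)
    have e1 := hper _ hu
    rw [show (τ + (-1 : ℝ)) / 3 + 1 = (τ + (2 : ℝ)) / 3 by push_cast; ring] at e1
    rw [e1]
    set u := (τ + (-1 : ℝ)) / 3 with hudef
    have hu0 := ne_zero_of_im hu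
    have hv := mobius_im hu
    have hv' : 0 < (-1 / (3 * u) - 1).im := by simpa using hv
    have e2 := hper _ hv'
    rw [sub_add_cancel, hW u hu] at e2
    have e3 := hW _ hv'
    have hτu : τ = 3 * u + 1 := by rw [hudef]; push_cast; ring
    have hx : 3 * (-1 / (3 * u) - 1) = -τ / u := by rw [hτu]; field_simp; ring
    have hy : (-1 / (3 * u) - 1) = -τ / u / 3 := by rw [← hx]; ring
    rw [← e2, hx, hy] at e3
    rw [show (-1 / τ + (1 : ℝ)) / 3 = -1 / (-τ / u) by
      push_cast; field_simp; rw [hτu]; ring, e3]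
    have : c * (-τ / u / 3) ^ k * (c * u ^ k * f u) = c ^ 2 * (-τ / u / 3 * u) ^ k * f u := by
      rw [mul_pow]; ring
    rw [this, hc, ← mul_pow]
    congr 2
    field_simp
  have h4 : f ((-1 / τ + (2 : ℝ)) / 3) = (-τ) ^ k * f ((τ + (1 : ℝ)) / 3) := by
    have hu : 0 < ((τ + (1 : ℝ)) / 3).im := add_div_three_im hτ 1
    set u := (τ + (1 : ℝ)) / 3 with hudef
    have hu0 := ne_zero_of_im hu
    have hv := mobius_im hu
    have hv' : 0 < (-1 / (3 * u) + 1).im := by simpa using hv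
    have e2 := hper _ hv
    rw [hW u hu] at e2
    have e3 := hW _ hv'
    have hτu : τ = 3 * u - 1 := by rw [hudef]; push_cast; ring
    have hx : 3 * (-1 / (3 * u) + 1) = τ / u := by rw [hτu]; field_simp; ring
    have hy : (-1 / (3 * u) + 1) = τ / u / 3 := by rw [← hx]; ring
    rw [e2, hx, hy] at e3
    have e4 := hper ((-1 / τ + (-1 : ℝ)) / 3) (add_div_three_im (neg_inv_im hτ) (-1))
    rw [show (-1 / τ + (2 : ℝ)) / 3 = (-1 / τ + (-1 : ℝ)) / 3 + 1 by push_cast; ring, e4,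
      show (-1 / τ + (-1 : ℝ)) / 3 = -1 / (τ / u) by
      push_cast; field_simp; rw [hτu]; ring, e3]
    have : c * (τ / u / 3) ^ k * (c * u ^ k * f u) = c ^ 2 * (τ / u / 3 * u) ^ k * f u := by
      rw [mul_pow]; ring
    rw [this, hc, ← mul_pow]
    congr 2
    field_simp
  unfold nrm
  rw [h1, h2, h3, h4]
  have e : c ^ 2 * (τ / 3) ^ k * τ ^ k * τ ^ k * (-τ) ^ k = τ ^ (4 * k) := by
    rw [hc, ← mul_pow, ← mul_pow, ← mul_pow, ← mul_pow, pow_mul]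
    congr 1
    ring
  rw [← e]
  ring

lemma key_zero (f : ℂ → ℂ) (k : ℕ) (hk : k < 6) (c : ℂ) (hc : c ^ 2 = (-3) ^ k)
    (hol : DifferentiableOn ℂ f {z | 0 < z.im})
    (hper : ∀ τ : ℂ, 0 < τ.im → f (τ + 1) = f τ)
    (hW : ∀ τ : ℂ, 0 < τ.im → f (-1 / (3 * τ)) = c * τ ^ k * f τ)
    (hlim : Filter.Tendsto f Iinf (nhds 0)) :
    ∀ τ : ℂ, 0 < τ.im → f τ = 0 := by
  have hdec := decay_H hol hper hlim
  have hn : ∀ τ : ℂ, 0 < τ.im → nrm f τ / dedekindEta τ ^ 48 = 0 := by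
    refine levelOne_aux (fun τ => nrm f τ / dedekindEta τ ^ 48) (4 * k - 24) (by omega)
      ((nrm_diff hol).div (eta_diff.pow 48) fun z hz => pow_ne_zero _ (eta_ne hz)) ?_ ?_ ?_
    · intro τ hτ
      rw [nrm_T hper hτ, eta_add_one, mul_pow, ← Complex.exp_nat_mul,
        show ((48 : ℕ) : ℂ) * (Real.pi * I / 12) = (2 : ℕ) * (2 * Real.pi * I) by push_cast; ring,
        Complex.exp_nat_mul_two_pi_mul_I, one_mul]
    · intro τ hτ
      have hτ0 := ne_zero_of_im hτ
      have he := eta_ne hτ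
      have hI : (-I) ^ 24 = 1 := by
        have h2 : (-I) ^ 2 = -1 := by rw [neg_sq, Complex.I_sq]
        calc (-I) ^ 24 = ((-I) ^ 2) ^ 12 := by rw [← pow_mul]
          _ = 1 := by rw [h2]; norm_num
      have h48 : dedekindEta (-1 / τ) ^ 48 = τ ^ 24 * dedekindEta τ ^ 48 := by
        calc dedekindEta (-1 / τ) ^ 48 = (dedekindEta (-1 / τ) ^ 2) ^ 24 := by rw [← pow_mul]
          _ = _ := by rw [eta_S_sq hτ, mul_pow, mul_pow, hI, ← pow_mul, one_mul]
      rw [nrm_S hc hper hW hτ, h48, zpow_sub₀ hτ0]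
      have e1 : τ ^ (4 * (k : ℤ)) = τ ^ (4 * k) := by
        rw [← zpow_natCast]; push_cast; rfl
      have e2 : τ ^ (24 : ℤ) = τ ^ 24 := by norm_cast
      rw [e1, e2]
      field_simp
    · have h1 := hdec.mul ((decay_div hdec 0).mul ((decay_div hdec 1).mul (decay_div hdec 2)))
      have h2 : (fun z => (uProd z ^ 48)⁻¹) =O[Iinf] fun _ => (1 : ℝ) := by
        have : Filter.Tendsto (fun z => (uProd z ^ 48)⁻¹) Iinf (nhds (1 ^ 48)⁻¹) :=
          (tendsto_uProd.pow 48).inv₀ (by simp)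
        exact this.isBigO_one ℝ
      have h3 : (fun z : ℂ => (Complex.exp (4 * Real.pi * I * z))⁻¹) =O[Iinf]
          fun z => Real.exp (4 * Real.pi * z.im) := by
        refine Asymptotics.IsBigO.of_bound 1 (Filter.Eventually.of_forall fun z => ?_)
        rw [← Complex.exp_neg, Complex.norm_exp]
        simp
      have h4 := (h1.mul h3).mul h2
      have h5 : (fun τ => nrm f τ / dedekindEta τ ^ 48) =O[Iinf] fun _ => (1 : ℝ) := by
        refine h4.congr (fun z => ?_) fun z => ?_
        · rw [dedekindEta_eq, mul_pow, ← Complex.exp_nat_mul,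
            show ((48 : ℕ) : ℂ) * (Real.pi * I * z / 12) = 4 * Real.pi * I * z by push_cast; ring]
          simp only [nrm, div_eq_mul_inv, mul_inv]
          ring
        · rw [← Real.exp_add, ← Real.exp_add, ← Real.exp_add, ← Real.exp_add, mul_one,
            Real.exp_eq_one_iff]
          ring
      obtain ⟨C, hC⟩ := h5.bound
      rw [Filter.eventually_comap, Filter.eventually_atTop] at hC
      obtain ⟨Y, hY⟩ := hC
      exact ⟨C, Y, fun τ hτ => by simpa using hY _ hτ τ rfl⟩
  have hn' : ∀ τ : ℂ, 0 < τ.im → nrm f τ = 0 := fun τ hτ => by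
    have := hn τ hτ
    rcases div_eq_zero_iff.mp this with h | h
    · exact h
    · exact absurd h (pow_ne_zero _ (eta_ne hτ))
  have hdiv : ∀ j : ℝ, (∀ τ : ℂ, 0 < τ.im → f ((τ + j) / 3) = 0) →
      ∀ τ : ℂ, 0 < τ.im → f τ = 0 := by
    intro j h τ hτ
    have := h (3 * τ - j) (by simpa using hτ)
    rwa [sub_add_cancel, mul_div_cancel_left₀ _ (by norm_num)] at this
  rcases mul_zero_H hol ((diff_div hol 0).mul ((diff_div hol 1).mul (diff_div hol 2))) hn'
    with h | h
  · exact h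
  rcases mul_zero_H (diff_div hol 0) ((diff_div hol 1).mul (diff_div hol 2)) h with h | h
  · exact hdiv 0 h
  rcases mul_zero_H (diff_div hol 1) (diff_div hol 2) h with h | h
  · exact hdiv 1 h
  · exact hdiv 2 h


lemma gauss_summable {y : ℝ} (hy : 0 < y) :
    Summable fun n : ℤ => Real.exp (-Real.pi * y * (n : ℝ) ^ 2) := by
  have h := ((summable_jacobiTheta₂_term_iff 0 ((y : ℂ) * I)).mpr (by simpa using hy)).norm
  refine h.congr fun n => ?_
  rw [norm_jacobiTheta₂_term]
  congr 1
  simp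
  ring

lemma gauss_prod_summable {y z : ℝ} (hy : 0 < y) (hz : 0 < z) :
    Summable fun p : ℤ × ℤ => Real.exp (-Real.pi * y * (p.1 : ℝ) ^ 2) *
      Real.exp (-Real.pi * z * (p.2 : ℝ) ^ 2) :=
  (gauss_summable hy).mul_of_nonneg (gauss_summable hz) (fun _ => (Real.exp_pos _).le)
    (fun _ => (Real.exp_pos _).le)

lemma qq_zpow (τ : ℂ) (k : ℤ) : qq τ ^ k = cexp (2 * Real.pi * I * τ * k) := by
  rw [qq, ← Complex.exp_int_mul]
  congr 1
  ring

lemma norm_term_le {τ : ℂ} {y : ℝ} (hy : 0 < y) (h : y ≤ τ.im) (p : ℤ × ℤ) :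
    ‖qq τ ^ (p.1 ^ 2 + p.1 * p.2 + p.2 ^ 2)‖ ≤ Real.exp (-Real.pi * y * (p.1 : ℝ) ^ 2) *
      Real.exp (-Real.pi * y * (p.2 : ℝ) ^ 2) := by
  rw [qq_zpow, Complex.norm_exp, ← Real.exp_add, Real.exp_le_exp]
  have e : (2 * Real.pi * I * τ * ((p.1 ^ 2 + p.1 * p.2 + p.2 ^ 2 : ℤ) : ℂ)).re
      = -(2 * Real.pi * τ.im * ((p.1 : ℝ) ^ 2 + p.1 * p.2 + (p.2 : ℝ) ^ 2)) := by
    rw [show (2 * Real.pi * I * τ * ((p.1 ^ 2 + p.1 * p.2 + p.2 ^ 2 : ℤ) : ℂ)) =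
      ((2 * Real.pi * ((p.1 : ℝ) ^ 2 + p.1 * p.2 + (p.2 : ℝ) ^ 2) : ℝ) : ℂ) * (I * τ) by
        push_cast; ring, Complex.re_ofReal_mul]
    simp
    ring
  rw [e]
  have h1 : ((p.1 : ℝ) ^ 2 + (p.2 : ℝ) ^ 2) / 2 ≤ (p.1 : ℝ) ^ 2 + p.1 * p.2 + (p.2 : ℝ) ^ 2 := by
    nlinarith [sq_nonneg ((p.1 : ℝ) + p.2)]
  have h2 : y * (((p.1 : ℝ) ^ 2 + (p.2 : ℝ) ^ 2) / 2) ≤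
      τ.im * ((p.1 : ℝ) ^ 2 + p.1 * p.2 + (p.2 : ℝ) ^ 2) :=
    mul_le_mul h h1 (by positivity) (hy.le.trans h)
  nlinarith [mul_le_mul_of_nonneg_left h2 Real.pi_pos.le]

lemma A3_diff : DifferentiableOn ℂ A3 {z | 0 < z.im} := by
  intro τ hτ
  have hτ' : 0 < τ.im := hτ
  have hy : 0 < τ.im / 2 := by positivity
  have hopen : IsOpen {z : ℂ | τ.im / 2 < z.im} := isOpen_lt continuous_const Complex.continuous_im
  have := differentiableOn_tsum_of_summable_norm 
    (F := fun (p : ℤ × ℤ) z => qq z ^ (p.1 ^ 2 + p.1 * p.2 + p.2 ^ 2))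
    (gauss_prod_summable hy hy) (fun p => by
      refine Differentiable.differentiableOn ?_
      simp only [qq_zpow]
      fun_prop) hopen (fun p w hw => norm_term_le hy (le_of_lt hw) p)
  exact (this.differentiableAt (hopen.mem_nhds (show τ.im / 2 < τ.im by linarith))).differentiableWithinAt

lemma A3_add_one (τ : ℂ) : A3 (τ + 1) = A3 τ := by
  unfold A3
  rw [qq_add_one]

lemma A3_lim : Filter.Tendsto A3 Iinf (nhds 1) := by
  have := tendsto_tsum_of_dominated_convergence (𝓕 := Iinf)
    (f := fun z (p : ℤ × ℤ) => qq z ^ (p.1 ^ 2 + p.1 * p.2 + p.2 ^ 2))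
    (g := fun p => if p = (0, 0) then (1 : ℂ) else 0)
    (gauss_prod_summable one_pos one_pos) ?_ ?_
  · rwa [tsum_ite_eq] at this
  · intro p
    by_cases hp : p = (0, 0)
    · subst hp
      simpa using tendsto_const_nhds
    · simp only [hp, if_false]
      have hQ : 0 < p.1 ^ 2 + p.1 * p.2 + p.2 ^ 2 := by
        by_contra hcon
        have h1 : p.1 ^ 2 + p.2 ^ 2 ≤ 0 := by nlinarith [sq_nonneg (p.1 + p.2)]
        have h2 : p.1 = 0 := by nlinarith [sq_nonneg p.1, sq_nonneg p.2]
        have h3 : p.2 = 0 := by nlinarith [sq_nonneg p.1, sq_nonneg p.2]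
        exact hp (Prod.ext h2 h3)
      obtain ⟨n, hn⟩ := Int.eq_ofNat_of_zero_le hQ.le
      rw [hn]
      simp only [zpow_natCast]
      have hn0 : n ≠ 0 := by rintro rfl; simp at hn; omega
      simpa [hn0] using tendsto_qq.pow n
  · have : ∀ᶠ z in Iinf, (1 : ℝ) ≤ z.im := by
      exact Filter.tendsto_comap.eventually_ge_atTop 1
    filter_upwards [this] with z hz p
    exact norm_term_le one_pos hz p

/-- The kernel after partial Poisson summation. -/
def gker (τ : ℂ) (n k : ℤ) : ℂ :=
  cexp (Real.pi * I * (3 / 2) * τ * n ^ 2 + Real.pi * I * k * n + Real.pi * I * (-1 / (2 * τ)) * k ^ 2)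

lemma gker_swap {τ : ℂ} (hτ : τ ≠ 0) (n k : ℤ) : gker (-1 / (3 * τ)) n k = gker τ k n := by
  unfold gker
  congr 1
  field_simp
  ring

lemma two_mul_im {τ : ℂ} (hτ : 0 < τ.im) : 0 < (2 * τ).im := by simpa using hτ

lemma gker_summable {τ : ℂ} (hτ : 0 < τ.im) :
    Summable (Function.uncurry (gker τ)) := by
  have h2 : 0 < (-1 / (2 * τ)).im := neg_inv_im (two_mul_im hτ)
  refine Summable.of_norm ((gauss_prod_summable (y := 3 / 2 * τ.im) (by positivity) h2).congr ?_)
  rintro ⟨n, k⟩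
  simp only [Function.uncurry, gker]
  rw [Complex.norm_exp, ← Real.exp_add]
  congr 1
  generalize -1 / (2 * τ) = w
  rw [show (Real.pi * I * (3 / 2) * τ * n ^ 2 + Real.pi * I * k * n + Real.pi * I * w * k ^ 2 : ℂ)
    = ((Real.pi * (3 / 2) * n ^ 2 : ℝ) : ℂ) * (I * τ) + ((Real.pi * k * n : ℝ) : ℂ) * I
      + ((Real.pi * k ^ 2 : ℝ) : ℂ) * (I * w) by push_cast; ring]
  rw [add_re, add_re, Complex.re_ofReal_mul, Complex.re_ofReal_mul, Complex.re_ofReal_mul]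
  simp
  ring

lemma A3_eq_gker {τ : ℂ} (hτ : 0 < τ.im) :
    A3 τ = 1 / (-I * (2 * τ)) ^ (1 / 2 : ℂ) * ∑' n : ℤ, ∑' k : ℤ, gker τ n k := by
  have hτ0 := ne_zero_of_im hτ
  have hs : Summable fun p : ℤ × ℤ => qq τ ^ (p.1 ^ 2 + p.1 * p.2 + p.2 ^ 2) :=
    Summable.of_norm_bounded (gauss_prod_summable hτ hτ) (norm_term_le hτ le_rfl)
  unfold A3
  rw [hs.tsum_prod, ← tsum_mul_left]
  refine tsum_congr fun n => ?_
  have h1 : ∑' m : ℤ, qq τ ^ (n ^ 2 + n * m + m ^ 2) =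
      cexp (2 * Real.pi * I * τ * n ^ 2) * jacobiTheta₂ (n * τ) (2 * τ) := by
    unfold jacobiTheta₂
    rw [← tsum_mul_left]
    refine tsum_congr fun m => ?_
    rw [qq_zpow, jacobiTheta₂_term, ← Complex.exp_add]
    congr 1
    push_cast
    ring
  rw [h1, jacobiTheta₂_functional_equation]
  unfold jacobiTheta₂
  have h2 : ∑' k : ℤ, gker τ n k = cexp (2 * Real.pi * I * τ * n ^ 2) *
      (cexp (-Real.pi * I * (n * τ) ^ 2 / (2 * τ)) *
        ∑' k : ℤ, jacobiTheta₂_term k (n * τ / (2 * τ)) (-1 / (2 * τ))) := by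
    rw [← tsum_mul_left, ← tsum_mul_left]
    refine tsum_congr fun k => ?_
    rw [jacobiTheta₂_term, gker, ← Complex.exp_add, ← Complex.exp_add]
    congr 1
    field_simp
    ring
  rw [h2]
  ring

lemma sqrt_ofReal_mul {r : ℝ} (hr : 0 < r) {z : ℂ} (hz : z ≠ 0) (a : ℂ) :
    ((r : ℂ) * z) ^ a = (r : ℂ) ^ a * z ^ a := by
  have hr0 : (r : ℂ) ≠ 0 := by exact_mod_cast hr.ne'
  rw [Complex.cpow_def_of_ne_zero (mul_ne_zero hr0 hz), Complex.cpow_def_of_ne_zero hr0,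
    Complex.cpow_def_of_ne_zero hz, ← Complex.exp_add, Complex.log_ofReal_mul hr hz,
    Complex.ofReal_log hr.le]
  ring_nf

lemma half_sq (z : ℂ) : (z ^ (1 / 2 : ℂ)) ^ 2 = z := by
  rw [← Complex.cpow_nat_mul]; simp

lemma real_half {r : ℝ} (hr : 0 ≤ r) : (r : ℂ) ^ (1 / 2 : ℂ) = (Real.sqrt r : ℂ) := by
  rw [Real.sqrt_eq_rpow, Complex.ofReal_cpow hr]; push_cast; rfl

lemma A3_W {τ : ℂ} (hτ : 0 < τ.im) :
    A3 (-1 / (3 * τ)) = -(Real.sqrt 3 : ℂ) * I * τ * A3 τ := by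
  have hτ0 := ne_zero_of_im hτ
  rw [A3_eq_gker hτ, A3_eq_gker (mobius_im hτ)]
  have h1 : ∑' n : ℤ, ∑' k : ℤ, gker (-1 / (3 * τ)) n k = ∑' n : ℤ, ∑' k : ℤ, gker τ n k := by
    simp only [gker_swap hτ0]
    exact (gker_summable hτ).tsum_comm
  rw [h1, ← mul_assoc (-(Real.sqrt 3 : ℂ) * I * τ)]
  congr 1
  set x := -I * (2 * τ) with hx
  have hx0 : x ≠ 0 := by simp [hx, hτ0]
  have hxre : 0 < x.re := by simp [hx]; exact hτ
  have harg : x.arg ≠ Real.pi := by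
    intro h
    have := (Complex.arg_eq_pi_iff.mp h).1
    linarith
  have e1 : -I * (2 * (-1 / (3 * τ))) = ((4 / 3 : ℝ) : ℂ) * x⁻¹ := by
    rw [hx]; push_cast; field_simp; ring_nf; simp
  rw [e1, sqrt_ofReal_mul (by norm_num) (inv_ne_zero hx0), Complex.inv_cpow _ _ harg,
    real_half (by norm_num)]
  have hs := half_sq x
  have hs0 : x ^ (1 / 2 : ℂ) ≠ 0 := by
    intro h; rw [h] at hs; simp at hs; exact hx0 hs.symm
  have h43 : Real.sqrt (4 / 3) = 2 / Real.sqrt 3 := by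
    rw [Real.sqrt_div (by norm_num), show (4 : ℝ) = 2 ^ 2 by norm_num, Real.sqrt_sq (by norm_num)]
  have h3 : (Real.sqrt 3 : ℂ) ≠ 0 := by
    have : Real.sqrt 3 ≠ 0 := by positivity
    exact_mod_cast this
  rw [h43]
  push_cast
  field_simp
  rw [hs, hx]
  ring


/-- The Fricke constant. -/
def cA : ℂ := -(Real.sqrt 3 : ℂ) * I

lemma sqrt3_sq : (Real.sqrt 3 : ℂ) ^ 2 = 3 := by
  have : Real.sqrt 3 ^ 2 = 3 := Real.sq_sqrt (by norm_num)
  exact_mod_cast this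

lemma sqrt3_ne : (Real.sqrt 3 : ℂ) ≠ 0 := by
  intro h; have := sqrt3_sq; rw [h] at this; norm_num at this

lemma cA_sq : cA ^ 2 = -3 := by
  rw [cA, mul_pow, neg_sq, sqrt3_sq, I_sq]; ring

lemma csqrt_sq (z : ℂ) : Complex.sqrt z ^ 2 = z := by
  rw [Complex.sqrt, ← Complex.cpow_nat_mul]; simp

lemma csqrt_ne {z : ℂ} (hz : z ≠ 0) : Complex.sqrt z ≠ 0 := by
  intro h; have := csqrt_sq z; rw [h] at this; simp at this; exact hz this.symm

lemma csqrt_three {z : ℂ} (hz : z ≠ 0) : Complex.sqrt (3 * z) = (Real.sqrt 3 : ℂ) * Complex.sqrt z := by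
  have h := sqrt_ofReal_mul (r := 3) (by norm_num) hz (2⁻¹)
  have h2 := real_half (r := 3) (by norm_num)
  rw [one_div] at h2
  rw [h2] at h
  simpa [Complex.sqrt] using h

lemma eta_W {τ : ℂ} (hτ : 0 < τ.im) : dedekindEta (-1 / (3 * τ)) =
    (Complex.sqrt I)⁻¹ * ((Real.sqrt 3 : ℂ) * Complex.sqrt τ * dedekindEta (3 * τ)) := by
  rw [eta_S (mul_three_im hτ), csqrt_three (ne_zero_of_im hτ)]

lemma three_mobius {τ : ℂ} (hτ : τ ≠ 0) : 3 * (-1 / (3 * τ)) = -1 / τ := by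
  field_simp

lemma B3_W {τ : ℂ} (hτ : 0 < τ.im) : B3 (-1 / (3 * τ)) = cA * τ * C3 τ := by
  have hτ0 := ne_zero_of_im hτ
  unfold B3 C3
  rw [three_mobius hτ0, eta_W hτ, eta_S hτ]
  have hs := csqrt_sq I
  have ht := csqrt_sq τ
  have hs0 := csqrt_ne I_ne_zero
  have ht0 := csqrt_ne hτ0
  have he := eta_ne hτ
  have h3 := sqrt3_sq
  set s := Complex.sqrt I
  set t := Complex.sqrt τ
  set r := (Real.sqrt 3 : ℂ)
  have hc : cA = r * s⁻¹ ^ 2 := by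
    rw [inv_pow, hs, inv_I]; simp [cA, r]
  rw [hc, ← ht, ← h3]
  field_simp

lemma C3_W {τ : ℂ} (hτ : 0 < τ.im) : C3 (-1 / (3 * τ)) = cA * τ * B3 τ := by
  have hτ0 := ne_zero_of_im hτ
  unfold B3 C3
  rw [three_mobius hτ0, eta_W hτ, eta_S hτ]
  have hs := csqrt_sq I
  have ht := csqrt_sq τ
  have hs0 := csqrt_ne I_ne_zero
  have ht0 := csqrt_ne hτ0
  have he := eta_ne (mul_three_im hτ)
  have h3 := sqrt3_sq
  have h30 := sqrt3_ne
  have hc : cA = (Real.sqrt 3 : ℂ) * (Complex.sqrt I)⁻¹ ^ 2 := by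
    rw [inv_pow, hs, inv_I]; simp [cA]
  set s := Complex.sqrt I
  set t := Complex.sqrt τ
  set r := (Real.sqrt 3 : ℂ)
  rw [hc]
  generalize dedekindEta (3 * τ) = y at he ⊢
  generalize dedekindEta τ = x
  rw [← ht]
  field_simp
  linear_combination (-x ^ 3) * h3

lemma eta3_diff : DifferentiableOn ℂ (fun z => dedekindEta (3 * z)) {z | 0 < z.im} :=
  eta_diff.comp (f := fun z : ℂ => 3 * z) (by fun_prop) fun _ hz => mul_three_im hz

lemma B3_diff : DifferentiableOn ℂ B3 {z | 0 < z.im} :=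
  (eta_diff.pow 3).div eta3_diff fun _ hz => eta_ne (mul_three_im hz)

lemma C3_diff : DifferentiableOn ℂ C3 {z | 0 < z.im} :=
  ((eta3_diff.pow 3).const_mul 3).div eta_diff fun _ hz => eta_ne hz

lemma B3_ne {τ : ℂ} (hτ : 0 < τ.im) : B3 τ ≠ 0 :=
  div_ne_zero (pow_ne_zero _ (eta_ne hτ)) (eta_ne (mul_three_im hτ))

lemma C3_ne {τ : ℂ} (hτ : 0 < τ.im) : C3 τ ≠ 0 :=
  div_ne_zero (mul_ne_zero (by norm_num) (pow_ne_zero _ (eta_ne (mul_three_im hτ)))) (eta_ne hτ)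

lemma eta3_add_one (τ : ℂ) :
    dedekindEta (3 * (τ + 1)) = cexp (Real.pi * I / 12) ^ 3 * dedekindEta (3 * τ) := by
  rw [show 3 * (τ + 1) = 3 * τ + 1 + 1 + 1 by ring, eta_add_one, eta_add_one, eta_add_one]
  ring

lemma B3_add_one {τ : ℂ} (hτ : 0 < τ.im) : B3 (τ + 1) = B3 τ := by
  have := Complex.exp_ne_zero (Real.pi * I / 12)
  have := eta_ne (mul_three_im hτ)
  unfold B3
  rw [eta3_add_one, eta_add_one]
  field_simp

lemma C3_add_one {τ : ℂ} (hτ : 0 < τ.im) : C3 (τ + 1) ^ 3 = C3 τ ^ 3 := by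
  have h0 := Complex.exp_ne_zero (Real.pi * I / 12)
  have := eta_ne hτ
  have h24 : cexp (Real.pi * I / 12) ^ 24 = 1 := by
    rw [← Complex.exp_nat_mul, show ((24 : ℕ) : ℂ) * (Real.pi * I / 12) = 2 * Real.pi * I by
      push_cast; ring, Complex.exp_two_pi_mul_I]
  unfold C3
  rw [eta3_add_one, eta_add_one]
  set e := cexp (Real.pi * I / 12)
  calc _ = e ^ 24 * (3 * dedekindEta (3 * τ) ^ 3 / dedekindEta τ) ^ 3 := by
        field_simp
    _ = _ := by rw [h24, one_mul]

lemma tendsto_three : Filter.Tendsto (fun z : ℂ => 3 * z) Iinf Iinf := by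
  rw [Filter.tendsto_comap_iff]
  have : (Complex.im ∘ fun z : ℂ => 3 * z) = fun z => 3 * z.im := by
    funext z; simp
  rw [this]
  exact Filter.tendsto_comap.const_mul_atTop (by norm_num)

lemma B3_eq (τ : ℂ) : B3 τ = uProd τ ^ 3 / uProd (3 * τ) := by
  unfold B3
  rw [dedekindEta_eq, dedekindEta_eq, mul_pow, ← Complex.exp_nat_mul,
    show ((3 : ℕ) : ℂ) * (Real.pi * I * τ / 12) = Real.pi * I * (3 * τ) / 12 by push_cast; ring,
    mul_div_mul_left _ _ (Complex.exp_ne_zero _)]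

lemma C3_eq (τ : ℂ) : C3 τ ^ 3 = 27 * qq τ * (uProd (3 * τ) ^ 3 / uProd τ) ^ 3 := by
  unfold C3
  rw [dedekindEta_eq, dedekindEta_eq, mul_pow,
    show cexp (Real.pi * I * (3 * τ) / 12) = cexp (Real.pi * I * τ / 12) ^ 3 by
      rw [← Complex.exp_nat_mul]; congr 1; push_cast; ring,
    show qq τ = cexp (Real.pi * I * τ / 12) ^ 24 by
      rw [← Complex.exp_nat_mul, qq]; congr 1; push_cast; ring]
  have := Complex.exp_ne_zero (Real.pi * I * τ / 12)
  set e := cexp (Real.pi * I * τ / 12)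
  field_simp
  ring

lemma B3_lim : Filter.Tendsto B3 Iinf (nhds 1) := by
  have := (tendsto_uProd.pow 3).div (tendsto_uProd.comp tendsto_three) one_ne_zero
  rw [one_pow, div_one] at this
  exact this.congr fun z => (B3_eq z).symm

lemma C3_lim : Filter.Tendsto (fun z => C3 z ^ 3) Iinf (nhds 0) := by
  have := (tendsto_qq.const_mul 27).mul
    ((((tendsto_uProd.comp tendsto_three).pow 3).div tendsto_uProd one_ne_zero).pow 3)
  rw [mul_zero, zero_mul] at this
  exact this.congr fun z => (C3_eq z).symm

lemma cubic {τ : ℂ} (hτ : 0 < τ.im) : A3 τ ^ 3 = B3 τ ^ 3 + C3 τ ^ 3 := by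
  have := key_zero (fun z => A3 z ^ 3 - (B3 z ^ 3 + C3 z ^ 3)) 3 (by norm_num) (cA ^ 3)
    (by rw [← pow_mul, mul_comm, pow_mul, cA_sq])
    ((A3_diff.pow 3).sub ((B3_diff.pow 3).add (C3_diff.pow 3)))
    (fun z hz => by rw [A3_add_one, B3_add_one hz, C3_add_one hz])
    (fun z hz => by
      rw [A3_W hz, B3_W hz, C3_W hz, ← cA]; ring)
    (by
      have := (A3_lim.pow 3).sub ((B3_lim.pow 3).add C3_lim)
      simpa using this) τ hτ
  exact sub_eq_zero.mp this


lemma diffAt_H {f : ℂ → ℂ} (hf : DifferentiableOn ℂ f {z | 0 < z.im}) {τ : ℂ} (hτ : 0 < τ.im) :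
    DifferentiableAt ℂ f τ := hf.differentiableAt (isOpen_H.mem_nhds hτ)

lemma eventually_H {f g : ℂ → ℂ} (h : ∀ τ : ℂ, 0 < τ.im → f τ = g τ) {τ : ℂ} (hτ : 0 < τ.im) :
    f =ᶠ[nhds τ] g := by
  filter_upwards [isOpen_H.mem_nhds hτ] with w hw
  exact h w hw

lemma deriv_eq_H {f g : ℂ → ℂ} (h : ∀ τ : ℂ, 0 < τ.im → f τ = g τ) {τ : ℂ} (hτ : 0 < τ.im) :
    deriv f τ = deriv g τ := (eventually_H h hτ).deriv_eq

lemma deriv_diff_H {f : ℂ → ℂ} (hf : DifferentiableOn ℂ f {z | 0 < z.im}) :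
    DifferentiableOn ℂ (deriv f) {z | 0 < z.im} := hf.deriv isOpen_H

lemma deriv_per_H {f : ℂ → ℂ} (h : ∀ τ : ℂ, 0 < τ.im → f (τ + 1) = f τ) {τ : ℂ} (hτ : 0 < τ.im) :
    deriv f (τ + 1) = deriv f τ := by
  rw [← deriv_comp_add_const]
  exact deriv_eq_H h hτ

lemma deriv_lim_H {f : ℂ → ℂ} {c : ℂ} (hf : DifferentiableOn ℂ f {z | 0 < z.im})
    (hl : Filter.Tendsto f Iinf (nhds c)) : Filter.Tendsto (deriv f) Iinf (nhds 0) := by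
  rw [Metric.tendsto_nhds]
  intro ε hε
  have h1 : ∀ᶠ z in Iinf, dist (f z) c < ε / 2 := (Metric.tendsto_nhds.mp hl) _ (by positivity)
  rw [Filter.eventually_comap, Filter.eventually_atTop] at h1
  obtain ⟨Y, hY⟩ := h1
  have h2 : ∀ᶠ z : ℂ in Iinf, max Y 0 + 2 ≤ z.im := Filter.tendsto_comap.eventually_ge_atTop _
  filter_upwards [h2] with z hz
  have him : ∀ w ∈ Metric.closedBall z 1, max Y 0 < w.im := by
    intro w hw
    rw [Metric.mem_closedBall, dist_eq_norm] at hw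
    have h3 := (Complex.abs_im_le_norm (w - z)).trans hw
    rw [Complex.sub_im] at h3
    have := (abs_le.mp h3).1
    linarith
  have hd : DiffContOnCl ℂ (fun w => f w - c) (Metric.ball z 1) := by
    refine DifferentiableOn.diffContOnCl ?_
    rw [closure_ball z one_ne_zero]
    exact (hf.mono fun w hw => lt_of_le_of_lt (le_max_right Y 0) (him w hw)).sub_const c
  have h4 := Complex.norm_deriv_le_of_forall_mem_sphere_norm_le (C := ε / 2) one_pos hd (by
    intro w hw
    have := hY w.im ((le_max_left Y 0).trans (him w (Metric.sphere_subset_closedBall hw)).le) w rfl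
    rw [dist_eq_norm] at this
    exact this.le)
  rw [deriv_sub_const, div_one] at h4
  rw [dist_zero_right]
  linarith

/-- The weight two Eisenstein series as a logarithmic derivative. -/
def PE (τ : ℂ) : ℂ := 12 / (Real.pi * I) * (deriv dedekindEta τ / dedekindEta τ)

lemma piI_ne : (Real.pi * I : ℂ) ≠ 0 := by
  have : (Real.pi : ℂ) ≠ 0 := by exact_mod_cast Real.pi_ne_zero
  exact mul_ne_zero this I_ne_zero

lemma eta_hasDeriv {τ : ℂ} (hτ : 0 < τ.im) :
    HasDerivAt dedekindEta (Real.pi * I / 12 * PE τ * dedekindEta τ) τ := by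
  have h := (diffAt_H eta_diff hτ).hasDerivAt
  refine h.congr_deriv ?_
  have h1 := piI_ne
  have h2 := eta_ne hτ
  unfold PE
  field_simp

lemma eta3_hasDeriv {τ : ℂ} (hτ : 0 < τ.im) :
    HasDerivAt (fun z => dedekindEta (3 * z))
      (Real.pi * I / 4 * PE (3 * τ) * dedekindEta (3 * τ)) τ := by
  have h := (eta_hasDeriv (mul_three_im hτ)).comp τ ((hasDerivAt_id τ).const_mul 3)
  refine h.congr_deriv ?_
  ring

lemma PE_diff : DifferentiableOn ℂ PE {z | 0 < z.im} :=
  ((deriv_diff_H eta_diff).div eta_diff fun _ hz => eta_ne hz).const_mul _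

lemma PE3_diff : DifferentiableOn ℂ (fun z => PE (3 * z)) {z | 0 < z.im} :=
  PE_diff.comp (f := fun z : ℂ => 3 * z) (by fun_prop) fun _ hz => mul_three_im hz

lemma PE_add_one {τ : ℂ} : PE (τ + 1) = PE τ := by
  unfold PE
  have : deriv dedekindEta (τ + 1) = cexp (Real.pi * I / 12) * deriv dedekindEta τ := by
    rw [← deriv_comp_add_const, funext eta_add_one, deriv_const_mul_field]
  rw [this, eta_add_one, mul_div_mul_left _ _ (Complex.exp_ne_zero _)]

lemma PE3_add_one {τ : ℂ} : PE (3 * (τ + 1)) = PE (3 * τ) := by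
  rw [show 3 * (τ + 1) = 3 * τ + 1 + 1 + 1 by ring, PE_add_one, PE_add_one, PE_add_one]

lemma hasDeriv_mobius (a : ℂ) {τ : ℂ} (hτ : τ ≠ 0) (ha : a ≠ 0) :
    HasDerivAt (fun z : ℂ => -1 / (a * z)) (1 / (a * τ ^ 2)) τ := by
  have h := ((hasDerivAt_id τ).const_mul a).inv (mul_ne_zero ha hτ)
  have h2 := h.const_mul (-1)
  have h3 : HasDerivAt (fun z : ℂ => -1 / (a * z)) _ τ :=
    h2.congr_of_eventuallyEq (Filter.Eventually.of_forall fun z => by simp [div_eq_mul_inv])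
  refine h3.congr_deriv ?_
  simp only [id]
  field_simp

lemma PE_S {τ : ℂ} (hτ : 0 < τ.im) : PE (-1 / τ) = τ ^ 2 * PE τ + 6 * τ / (Real.pi * I) := by
  have hτ0 := ne_zero_of_im hτ
  have hm : HasDerivAt (fun z : ℂ => -1 / z) (1 / τ ^ 2) τ := by
    simpa using hasDeriv_mobius 1 hτ0 one_ne_zero
  have h1 := ((eta_hasDeriv (neg_inv_im hτ)).comp τ hm).pow 2
  have h2 := ((hasDerivAt_id τ).const_mul (-I)).mul ((eta_hasDeriv hτ).pow 2)
  have h3 : HasDerivAt (fun z => dedekindEta (-1 / z) ^ 2) _ τ :=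
    h2.congr_of_eventuallyEq (eventually_H (fun z hz => eta_S_sq hz) hτ)
  have h4 := h1.unique h3
  simp only [id, Function.comp] at h4
  have hS := eta_S_sq hτ
  have he := eta_ne hτ
  have hp := piI_ne
  have h5 : PE (-1 / τ) * (dedekindEta (-1 / τ) ^ 2) * (Real.pi * I) =
      (τ ^ 2 * PE τ + 6 * τ / (Real.pi * I)) * (-I * τ * dedekindEta τ ^ 2) * (Real.pi * I) := by
    have h6 : PE (-1 / τ) * (dedekindEta (-1 / τ) ^ 2) * (Real.pi * I) = 6 * τ ^ 2 *
        (2 * dedekindEta (-1 / τ) * (Real.pi * I / 12 * PE (-1 / τ) * dedekindEta (-1 / τ) *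
          (1 / τ ^ 2))) := by
      field_simp
      ring
    rw [h6]
    norm_num at h4
    have h7 : (τ ^ 2 * PE τ + 6 * τ / (Real.pi * I)) * (-I * τ * dedekindEta τ ^ 2) * (Real.pi * I)
      = (τ ^ 2 * PE τ * (Real.pi * I) + 6 * τ) * (-I * τ * dedekindEta τ ^ 2) := by
      generalize (Real.pi * I : ℂ) = P at hp ⊢
      field_simp
    rw [h7]
    rw [one_div]
    linear_combination (6 * τ ^ 2) * h4
  rw [hS] at h5
  refine mul_right_cancel₀ ?_ (mul_right_cancel₀ hp h5)
  simp [hτ0, he]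

lemma PE3_W {τ : ℂ} (hτ : 0 < τ.im) :
    PE (3 * (-1 / (3 * τ))) = τ ^ 2 * PE τ + 6 * τ / (Real.pi * I) := by
  rw [three_mobius (ne_zero_of_im hτ), PE_S hτ]

lemma PE_W {τ : ℂ} (hτ : 0 < τ.im) :
    PE (-1 / (3 * τ)) = 9 * τ ^ 2 * PE (3 * τ) + 18 * τ / (Real.pi * I) := by
  rw [PE_S (mul_three_im hτ)]; ring

lemma uProd_eq (τ : ℂ) : uProd τ = dedekindEta τ * cexp (-(Real.pi * I * τ / 12)) := by
  rw [dedekindEta_eq, mul_right_comm, ← Complex.exp_add]; simp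

lemma uProd_hasDeriv {τ : ℂ} (hτ : 0 < τ.im) :
    HasDerivAt uProd (Real.pi * I / 12 * (PE τ - 1) * uProd τ) τ := by
  rw [funext uProd_eq]
  have h1 : HasDerivAt (fun z : ℂ => -(Real.pi * I * z / 12)) (-(Real.pi * I * 1 / 12)) τ :=
    (((hasDerivAt_id τ).const_mul _).div_const 12).neg
  refine ((eta_hasDeriv hτ).mul h1.cexp).congr_deriv ?_
  ring

lemma PE_lim : Filter.Tendsto PE Iinf (nhds 1) := by
  have hd : DifferentiableOn ℂ uProd {z | 0 < z.im} := fun z hz =>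
    (uProd_hasDeriv hz).differentiableAt.differentiableWithinAt
  have h1 := (((deriv_lim_H hd tendsto_uProd).div tendsto_uProd one_ne_zero).const_mul
    (12 / (Real.pi * I))).add_const 1
  simp only [zero_div, mul_zero, zero_add] at h1
  refine h1.congr' ?_
  have h2 : ∀ᶠ z in Iinf, uProd z ≠ 0 := tendsto_uProd.eventually_ne one_ne_zero
  filter_upwards [Iinf_pos, h2] with z hz hu
  have hp := piI_ne
  simp only [Pi.div_apply]
  rw [(uProd_hasDeriv hz).deriv]
  field_simp
  ring

lemma PE3_lim : Filter.Tendsto (fun z => PE (3 * z)) Iinf (nhds 1) := PE_lim.comp tendsto_three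

/-- The weight two quasimodular form attached to C. -/
def Em (τ : ℂ) : ℂ := (9 * PE (3 * τ) - PE τ) / 8
/-- The weight two quasimodular form attached to B. -/
def Fm (τ : ℂ) : ℂ := 3 * (PE τ - PE (3 * τ)) / 8

lemma Em_diff : DifferentiableOn ℂ Em {z | 0 < z.im} :=
  ((PE3_diff.const_mul 9).sub PE_diff).div_const 8
lemma Fm_diff : DifferentiableOn ℂ Fm {z | 0 < z.im} :=
  ((PE_diff.sub PE3_diff).const_mul 3).div_const 8

lemma dq_C3 {τ : ℂ} (hτ : 0 < τ.im) : dq (fun t => C3 t ^ 3) τ = Em τ * C3 τ ^ 3 := by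
  have he := eta_ne hτ
  have h := ((((eta3_hasDeriv hτ).pow 3).const_mul 3).div (eta_hasDeriv hτ) he).pow 3
  have h' : deriv (fun t => C3 t ^ 3) τ = _ := h.deriv
  have hp := piI_ne
  unfold dq
  rw [h']
  simp only [Em, C3, Pi.div_apply]
  rw [show (2 * Real.pi * I : ℂ) = 2 * (Real.pi * I) by ring]
  generalize (Real.pi * I : ℂ) = P at hp ⊢
  push_cast
  simp only [Pi.pow_apply]
  generalize dedekindEta (3 * τ) = y at he ⊢
  generalize dedekindEta τ = x at he ⊢
  field_simp
  ring

lemma dq_B3 {τ : ℂ} (hτ : 0 < τ.im) : dq (fun t => B3 t ^ 3) τ = Fm τ * B3 τ ^ 3 := by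
  have he := eta_ne (mul_three_im hτ)
  have h := (((eta_hasDeriv hτ).pow 3).div (eta3_hasDeriv hτ) he).pow 3
  have h' : deriv (fun t => B3 t ^ 3) τ = _ := h.deriv
  have hp := piI_ne
  unfold dq
  rw [h']
  simp only [Fm, B3, Pi.div_apply]
  rw [show (2 * Real.pi * I : ℂ) = 2 * (Real.pi * I) by ring]
  generalize (Real.pi * I : ℂ) = P at hp ⊢
  push_cast
  simp only [Pi.pow_apply]
  generalize dedekindEta (3 * τ) = y at he ⊢
  generalize dedekindEta τ = x at he ⊢
  field_simp
  ring

lemma E3sig_eq {τ : ℂ} (hτ : 0 < τ.im) : E3sig τ = Em τ := by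
  unfold E3sig
  rw [dq_C3 hτ, mul_div_cancel_right₀ _ (pow_ne_zero _ (C3_ne hτ))]

lemma A_sq {τ : ℂ} (hτ : 0 < τ.im) : 2 * A3 τ ^ 2 = 3 * PE (3 * τ) - PE τ := by
  have := key_zero (fun z => 2 * A3 z ^ 2 - (3 * PE (3 * z) - PE z)) 2 (by norm_num) (-3) rfl
    (((A3_diff.pow 2).const_mul 2).sub ((PE3_diff.const_mul 3).sub PE_diff))
    (fun z hz => by rw [A3_add_one, PE_add_one, PE3_add_one])
    (fun z hz => by
      rw [A3_W hz, ← cA, PE3_W hz, PE_W hz]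
      linear_combination (2 * z ^ 2 * A3 z ^ 2) * cA_sq)
    (by
      have := ((A3_lim.pow 2).const_mul 2).sub ((PE3_lim.const_mul 3).sub PE_lim)
      norm_num at this
      exact this) τ hτ
  exact sub_eq_zero.mp this

lemma Fm_eq {τ : ℂ} (hτ : 0 < τ.im) : Fm τ = Em τ - A3 τ ^ 2 := by
  have := A_sq hτ
  unfold Fm Em
  linear_combination (1 / 2) * this

lemma dq_congr {f g : ℂ → ℂ} (h : ∀ τ : ℂ, 0 < τ.im → f τ = g τ) {τ : ℂ} (hτ : 0 < τ.im) :
    dq f τ = dq g τ := by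
  unfold dq; rw [deriv_eq_H h hτ]

lemma dq_add {f g : ℂ → ℂ} (hf : DifferentiableOn ℂ f {z | 0 < z.im})
    (hg : DifferentiableOn ℂ g {z | 0 < z.im}) {τ : ℂ} (hτ : 0 < τ.im) :
    dq (fun z => f z + g z) τ = dq f τ + dq g τ := by
  unfold dq
  rw [deriv_fun_add (diffAt_H hf hτ) (diffAt_H hg hτ)]; ring

lemma dq_sub {f g : ℂ → ℂ} (hf : DifferentiableOn ℂ f {z | 0 < z.im})
    (hg : DifferentiableOn ℂ g {z | 0 < z.im}) {τ : ℂ} (hτ : 0 < τ.im) :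
    dq (fun z => f z - g z) τ = dq f τ - dq g τ := by
  unfold dq
  rw [deriv_fun_sub (diffAt_H hf hτ) (diffAt_H hg hτ)]; ring

lemma dq_pow {f : ℂ → ℂ} (hf : DifferentiableOn ℂ f {z | 0 < z.im}) (n : ℕ)
    {τ : ℂ} (hτ : 0 < τ.im) :
    dq (fun z => f z ^ n) τ = n * f τ ^ (n - 1) * dq f τ := by
  unfold dq
  rw [deriv_fun_pow (diffAt_H hf hτ)]; ring

lemma dq_A3 {τ : ℂ} (hτ : 0 < τ.im) :
    dq (fun t => A3 t ^ 3) τ = Em τ * A3 τ ^ 3 - A3 τ ^ 2 * B3 τ ^ 3 := by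
  rw [dq_congr (fun z hz => cubic hz) hτ, dq_add (f := fun z => B3 z ^ 3) (g := fun z => C3 z ^ 3) (B3_diff.pow 3) (C3_diff.pow 3) hτ, dq_B3 hτ,
    dq_C3 hτ, Fm_eq hτ, cubic hτ]
  ring

/-- The sum of the two weight two forms. -/
def Gm (τ : ℂ) : ℂ := Em τ + Fm τ

lemma Gm_diff : DifferentiableOn ℂ Gm {z | 0 < z.im} := Em_diff.add Fm_diff

lemma Em_add_one (τ : ℂ) : Em (τ + 1) = Em τ := by unfold Em; rw [PE_add_one, PE3_add_one]
lemma Fm_add_one (τ : ℂ) : Fm (τ + 1) = Fm τ := by unfold Fm; rw [PE_add_one, PE3_add_one]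
lemma Gm_add_one (τ : ℂ) : Gm (τ + 1) = Gm τ := by unfold Gm; rw [Em_add_one, Fm_add_one]

lemma Em_W {τ : ℂ} (hτ : 0 < τ.im) :
    Em (-1 / (3 * τ)) = 3 * τ ^ 2 * Fm τ + 9 * τ / (2 * (Real.pi * I)) := by
  unfold Em Fm
  rw [PE3_W hτ, PE_W hτ]
  have := piI_ne
  field_simp
  ring

lemma Fm_W {τ : ℂ} (hτ : 0 < τ.im) :
    Fm (-1 / (3 * τ)) = 3 * τ ^ 2 * Em τ + 9 * τ / (2 * (Real.pi * I)) := by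
  unfold Em Fm
  rw [PE3_W hτ, PE_W hτ]
  have := piI_ne
  field_simp
  ring

lemma Gm_W {τ : ℂ} (hτ : 0 < τ.im) :
    Gm (-1 / (3 * τ)) = 3 * τ ^ 2 * Gm τ + 9 * τ / (Real.pi * I) := by
  unfold Gm
  rw [Em_W hτ, Fm_W hτ]
  have := piI_ne
  field_simp
  ring

lemma dG_W {τ : ℂ} (hτ : 0 < τ.im) : deriv Gm (-1 / (3 * τ)) =
    3 * τ ^ 2 * (6 * τ * Gm τ + 3 * τ ^ 2 * deriv Gm τ + 9 / (Real.pi * I)) := by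
  have hτ0 := ne_zero_of_im hτ
  have h1 := (diffAt_H Gm_diff (mobius_im hτ)).hasDerivAt.comp τ
    (hasDeriv_mobius 3 hτ0 (by norm_num))
  have h2 := ((((hasDerivAt_id τ).pow 2).const_mul 3).mul (diffAt_H Gm_diff hτ).hasDerivAt).add
    (((hasDerivAt_id τ).const_mul 9).div_const (Real.pi * I))
  have h3 := h2.congr_of_eventuallyEq (eventually_H (f := Gm ∘ fun z => -1 / (3 * z))
    (fun z hz => Gm_W hz) hτ)
  have h4 := h1.unique h3
  have hp := piI_ne
  have h5 : deriv Gm (-1 / (3 * τ)) = 3 * τ ^ 2 * (deriv Gm (-1 / (3 * τ)) * (1 / (3 * τ ^ 2))) := by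
    field_simp
  rw [h5, h4]
  simp only [id, Pi.pow_apply]
  push_cast
  ring

lemma Em_lim : Filter.Tendsto Em Iinf (nhds 1) := by
  have := ((PE3_lim.const_mul 9).sub PE_lim).div_const 8
  norm_num at this
  exact this

lemma Fm_lim : Filter.Tendsto Fm Iinf (nhds 0) := by
  have := ((PE_lim.sub PE3_lim).const_mul 3).div_const 8
  norm_num at this
  exact this

lemma Gm_lim : Filter.Tendsto Gm Iinf (nhds 1) := by
  have := Em_lim.add Fm_lim
  rwa [add_zero] at this

lemma dq_Gm {τ : ℂ} (hτ : 0 < τ.im) :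
    3 * dq Gm τ = Em τ ^ 2 + Fm τ ^ 2 - A3 τ ^ 4 := by
  have := key_zero (fun z => 3 * dq Gm z - (Em z ^ 2 + Fm z ^ 2 - A3 z ^ 4)) 4 (by norm_num) 9
    (by norm_num)
    ((((deriv_diff_H Gm_diff).const_mul _).const_mul 3).sub
      (((Em_diff.pow 2).add (Fm_diff.pow 2)).sub (A3_diff.pow 4)))
    (fun z hz => by
      unfold dq
      rw [A3_add_one, Em_add_one, Fm_add_one, deriv_per_H (fun w _ => Gm_add_one w) hz])
    (fun z hz => by
      have hp := piI_ne
      have h4 : cA ^ 4 = 9 := by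
        rw [show cA ^ 4 = (cA ^ 2) ^ 2 by ring, cA_sq]; norm_num
      have e : A3 (-1 / (3 * z)) ^ 4 = 9 * z ^ 4 * A3 z ^ 4 := by
        rw [A3_W hz, ← cA]; linear_combination (z ^ 4 * A3 z ^ 4) * h4
      unfold dq
      rw [e, dG_W hz, Em_W hz, Fm_W hz, Gm, show (2 * Real.pi * I : ℂ) = 2 * (Real.pi * I) by ring]
      generalize (Real.pi * I : ℂ) = P at hp ⊢
      field_simp
      ring)
    (by
      have := (((deriv_lim_H Gm_diff Gm_lim).const_mul (2 * Real.pi * I)⁻¹).const_mul 3).sub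
        (((Em_lim.pow 2).add (Fm_lim.pow 2)).sub (A3_lim.pow 4))
      norm_num at this
      unfold dq
      norm_num
      exact this) τ hτ
  exact sub_eq_zero.mp this

lemma dq_A_sq {τ : ℂ} (hτ : 0 < τ.im) :
    dq (fun t => A3 t ^ 2) τ = 2 / 3 * (Em τ * A3 τ ^ 2 - A3 τ * B3 τ ^ 3) := by
  have h := mul_zero_H (f := A3)
    (g := fun z => dq (fun t => A3 t ^ 2) z - 2 / 3 * (Em z * A3 z ^ 2 - A3 z * B3 z ^ 3)) A3_diff
    (((deriv_diff_H (A3_diff.pow 2)).const_mul _).sub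
      (((Em_diff.mul (A3_diff.pow 2)).sub (A3_diff.mul (B3_diff.pow 3))).const_mul _))
    (fun z hz => by
      have h1 := dq_A3 hz
      rw [dq_pow A3_diff 3 hz] at h1
      rw [dq_pow A3_diff 2 hz]
      push_cast at h1 ⊢
      linear_combination (2 / 3) * h1)
  rcases h with h | h
  · exfalso
    have h1 : A3 =ᶠ[Iinf] fun _ => 0 := by
      filter_upwards [Iinf_pos] with z hz using h z hz
    have hne : Iinf.NeBot := by
      refine Filter.comap_neBot fun t ht => ?_
      obtain ⟨y, hy⟩ := Filter.nonempty_of_mem ht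
      exact ⟨y * I, by simpa using hy⟩
    have := tendsto_nhds_unique (A3_lim.congr' h1) tendsto_const_nhds
    exact one_ne_zero this
  · exact sub_eq_zero.mp (h τ hτ)

lemma dq_Em {τ : ℂ} (hτ : 0 < τ.im) : 3 * dq Em τ = Em τ ^ 2 - A3 τ * B3 τ ^ 3 := by
  have h1 := dq_Gm hτ
  have h2 : dq Gm τ = dq Em τ + dq Fm τ := dq_add Em_diff Fm_diff hτ
  have h3 : dq Fm τ = dq Em τ - dq (fun t => A3 t ^ 2) τ := by
    rw [dq_congr (fun z hz => Fm_eq hz) hτ, dq_sub (g := fun z => A3 z ^ 2) Em_diff (A3_diff.pow 2) hτ]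
  rw [dq_A_sq hτ] at h3
  have h4 := Fm_eq hτ
  rw [h2, h3, h4] at h1
  linear_combination (1 / 2) * h1

theorem borwein_signature3_cubic_identity_and_system (τ : ℂ) (hτ : 0 < τ.im) :
    A3 τ ^ 3 = B3 τ ^ 3 + C3 τ ^ 3 ∧
    dq (fun t => A3 t ^ 3) τ = E3sig τ * A3 τ ^ 3 - A3 τ ^ 2 * B3 τ ^ 3 ∧
    dq (fun t => B3 t ^ 3) τ = E3sig τ * B3 τ ^ 3 - A3 τ ^ 2 * B3 τ ^ 3 ∧
    3 * dq E3sig τ = E3sig τ ^ 2 - A3 τ * B3 τ ^ 3 := by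
  refine ⟨cubic hτ, ?_, ?_, ?_⟩
  · rw [E3sig_eq hτ, dq_A3 hτ]
  · rw [E3sig_eq hτ, dq_B3 hτ, Fm_eq hτ]; ring
  · rw [dq_congr (fun z hz => E3sig_eq hz) hτ, E3sig_eq hτ, dq_Em hτ]
end
end

section
/- The signature-4 forms satisfy the quartic identity and a coupled system of nonlinear first-order differential equations: for all τ in the upper half-plane, (θ₂⁴ + θ₃⁴)² = ℬ₄⁴ + 𝒞₄⁴, and, setting X := θ₂⁴ + θ₃⁴ and ℰ₄ := (𝒞₄⁴)′/𝒞₄⁴, one has (X²)′ = ℰ₄·X² − X·ℬ₄⁴, (ℬ₄⁴)′ = ℰ₄·ℬ₄⁴ − X·ℬ₄⁴, and 4·ℰ₄′ = ℰ₄² − ℬ₄⁴. -/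
open Complex

noncomputable section

/-- X = θ₂⁴ + θ₃⁴. -/
def X4 (τ : ℂ) : ℂ := theta2 τ ^ 4 + theta3 τ ^ 4

/-- ℬ₄(τ) = η(τ)⁴/η(2τ)². -/
def B4 (τ : ℂ) : ℂ := dedekindEta τ ^ 4 / dedekindEta (2 * τ) ^ 2

/-- 𝒞₄⁴(τ) = 64·η(2τ)¹⁶/η(τ)⁸. -/
def C44 (τ : ℂ) : ℂ := 64 * dedekindEta (2 * τ) ^ 16 / dedekindEta τ ^ 8

/-- ℰ₄ := (𝒞₄⁴)′/𝒞₄⁴. -/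
def E4sig : ℂ → ℂ := fun τ => dq C44 τ / C44 τ

section
open Filter Topology ModularForm EisensteinSeries
open UpperHalfPlane hiding I
open scoped Real MatrixGroups Manifold
namespace Sig4


/-- The filter of neighbourhoods of `i∞` in `ℂ`. -/
def infty : Filter ℂ := comap Complex.im atTop

/-- The open upper half-plane as a subset of `ℂ`. -/
def HH : Set ℂ := {z | 0 < z.im}

lemma tendsto_coe_infty : Tendsto (fun z : UpperHalfPlane => (z : ℂ)) atImInfty infty := by
  rw [infty, tendsto_comap_iff]
  exact tendsto_comap

lemma isOpen_HH : IsOpen HH := isOpen_upperHalfPlaneSet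

lemma convex_HH : Convex ℝ HH := convex_halfSpace_im_gt 0

lemma HH_mem_infty : HH ∈ infty := by
  refine ⟨Set.Ioi 0, Ioi_mem_atTop 0, fun z hz => hz⟩

instance : infty.NeBot := by
  rw [infty, comap_neBot_iff]
  intro t ht
  obtain ⟨a, ha⟩ := (mem_atTop_sets.mp ht)
  exact ⟨⟨0, a⟩, ha a le_rfl⟩

lemma neg_inv_mem {z : ℂ} (hz : 0 < z.im) : 0 < (-1 / z).im := by
  have := UpperHalfPlane.im_inv_neg_coe_pos ⟨z, hz⟩
  rw [neg_div, one_div, ← inv_neg]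
  exact this

/-- A holomorphic function with level one transformation behaviour as a cusp form. -/
lemma exists_cuspForm (k : ℤ) (f : ℂ → ℂ) (hd : DifferentiableOn ℂ f HH)
    (hT : ∀ z : ℂ, 0 < z.im → f (z + 1) = f z)
    (hS : ∀ z : ℂ, 0 < z.im → f (-1 / z) = z ^ k * f z)
    (h0 : Tendsto f infty (𝓝 0)) :
    ∃ g : CuspForm 𝒮ℒ k, ∀ z : UpperHalfPlane, g z = f z := by
  set F : UpperHalfPlane → ℂ := fun z => f z with hF
  have h1 : F ∣[k] ModularGroup.S = F := by
    ext z
    rw [SlashInvariantForm.slash_S_apply]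
    simp only [hF]
    have := hS z z.2
    have e : (-(z : ℂ))⁻¹ = -1 / (z : ℂ) := by
      rw [inv_neg, neg_div, one_div]
    rw [e, this, zpow_neg]
    have hz : (z : ℂ) ^ k ≠ 0 := zpow_ne_zero _ (ne_zero z)
    field_simp
  have h2 : F ∣[k] ModularGroup.T = F := by
    ext z
    rw [SL_slash_apply, modular_T_smul, ModularGroup.denom_apply]
    simp only [hF]
    have := hT z z.2
    simp [ModularGroup.T, add_comm (1 : ℂ), this]
  have h3 := SlashInvariantForm.slash_action_generators_SL2Z h1 h2
  refine ⟨{ toFun := F, slash_action_eq' := ?_, holo' := ?_, zero_at_cusps' := ?_ }, fun z => rfl⟩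
  · rintro A ⟨A, rfl⟩
    exact h3 A
  · change MDiff F
    rw [UpperHalfPlane.mdifferentiable_iff]
    refine hd.congr fun z hz => ?_
    simp [hF, ofComplex_apply_of_im_pos hz]
  · intro c hc
    rw [Subgroup.IsArithmetic.isCusp_iff_isCusp_SL2Z] at hc
    rw [OnePoint.isZeroAt_iff_forall_SL2Z hc]
    intro γ _
    change IsZeroAtImInfty (F ∣[k] γ)
    rw [h3]
    exact h0.comp tendsto_coe_infty

lemma cusp_zero (k : ℤ) (hk : k < 12) (f : ℂ → ℂ) (hd : DifferentiableOn ℂ f HH)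
    (hT : ∀ z : ℂ, 0 < z.im → f (z + 1) = f z)
    (hS : ∀ z : ℂ, 0 < z.im → f (-1 / z) = z ^ k * f z)
    (h0 : Tendsto f infty (𝓝 0)) (z : ℂ) (hz : 0 < z.im) : f z = 0 := by
  obtain ⟨g, hg⟩ := exists_cuspForm k f hd hT hS h0
  have := rank_zero_iff_forall_zero.mp (CuspForm.rank_eq_zero_of_weight_lt_twelve hk) g
  rw [← hg ⟨z, hz⟩, this]
  rfl

lemma cusp_twelve (f : ℂ → ℂ) (hd : DifferentiableOn ℂ f HH)
    (hT : ∀ z : ℂ, 0 < z.im → f (z + 1) = f z)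
    (hS : ∀ z : ℂ, 0 < z.im → f (-1 / z) = z ^ (12 : ℤ) * f z)
    (h0 : Tendsto f infty (𝓝 0)) : ∃ c : ℂ, ∀ z : ℂ, 0 < z.im → f z = c * ModularForm.eta z ^ 24 := by
  obtain ⟨g, hg⟩ := exists_cuspForm 12 f hd hT hS h0
  obtain ⟨c, hc⟩ := CuspForm.exists_smul_discriminant_of_weight_eq_twelve g
  refine ⟨c, fun z hz => ?_⟩
  rw [← hg ⟨z, hz⟩, ← hc]
  rfl

/-! ### eta and E2 -/

lemma eta_eq : dedekindEta = ModularForm.eta := by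
  ext z
  simp only [dedekindEta, ModularForm.eta, eta_q_eq_pow, qq]
  congr 1
  rw [Function.Periodic.qParam]
  congr 1
  push_cast
  ring

/-- The Euler product as a function of q. -/
def euler (q : ℂ) : ℂ := ∏' n : ℕ, (1 - q ^ (n + 1))

lemma eta_euler (z : ℂ) : ModularForm.eta z = cexp (π * I * z / 12) * euler (cexp (2 * π * I * z)) := by
  rw [← eta_eq]; rfl

lemma tendsto_exp_infty {a : ℝ} (ha : 0 < a) : Tendsto (fun z : ℂ => cexp (a * I * z)) infty (𝓝 0) := by
  rw [tendsto_zero_iff_norm_tendsto_zero]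
  have : ∀ z : ℂ, ‖cexp (a * I * z)‖ = Real.exp (-(a * z.im)) := by
    intro z
    rw [Complex.norm_exp]
    simp
  simp_rw [this]
  refine Real.tendsto_exp_neg_atTop_nhds_zero.comp ?_
  exact (tendsto_id.const_mul_atTop ha).comp tendsto_comap

lemma tendsto_q_infty : Tendsto (fun z : ℂ => cexp (2 * π * I * z)) infty (𝓝 0) := by
  have := tendsto_exp_infty (a := 2 * π) (by positivity)
  push_cast at this
  exact this

lemma euler_tendsto : Tendsto euler (𝓝 0) (𝓝 1) := by
  have h := differentiableOn_tprod_one_sub_pow.differentiableAt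
    (Metric.isOpen_ball.mem_nhds (Metric.mem_ball_self (x := (0 : ℂ)) one_pos))
  have h2 := h.continuousAt.tendsto
  have : (∏' n : ℕ, (1 - (0 : ℂ) ^ (n + 1))) = 1 := by simp
  rw [this] at h2
  exact h2

lemma euler_infty : Tendsto (fun z : ℂ => euler (cexp (2 * π * I * z))) infty (𝓝 1) :=
  euler_tendsto.comp tendsto_q_infty

lemma tendsto_two_mul : Tendsto (fun z : ℂ => 2 * z) infty infty := by
  rw [infty, tendsto_comap_iff]
  have : (Complex.im ∘ fun z : ℂ => 2 * z) = fun z => 2 * z.im := by ext z; simp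
  rw [this]
  exact (tendsto_id.const_mul_atTop two_pos).comp tendsto_comap

lemma tendsto_half (c : ℝ) : Tendsto (fun z : ℂ => (z + c) / 2) infty infty := by
  rw [infty, tendsto_comap_iff]
  have : (Complex.im ∘ fun z : ℂ => (z + c) / 2) = fun z => 2⁻¹ * z.im := by
    ext z; simp; ring
  rw [this]
  exact (tendsto_id.const_mul_atTop (by norm_num)).comp tendsto_comap

/-- `E₂` as a function on `ℂ`. -/
def e2 (z : ℂ) : ℂ := E2 (ofComplex z)

lemma e2_coe (z : UpperHalfPlane) : e2 z = E2 z := by simp [e2]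

lemma e2_diff : DifferentiableOn ℂ e2 HH :=
  UpperHalfPlane.mdifferentiable_iff.mp E2_mdifferentiable

lemma deriv_eta {z : ℂ} (hz : 0 < z.im) :
    HasDerivAt ModularForm.eta (ModularForm.eta z * (π * I / 12 * e2 z)) z := by
  have h := (differentiableAt_eta_of_mem_upperHalfPlaneSet (z := z) hz).hasDerivAt
  have h2 := logDeriv_eta_eq_E2 ⟨z, hz⟩
  rw [← e2_coe] at h2
  rw [logDeriv_apply] at h2
  change deriv ModularForm.eta z / ModularForm.eta z = _ * e2 z at h2
  have h4 := eta_ne_zero (z := z) hz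
  have h3 : ModularForm.eta z * (π * I / 12 * e2 z) = deriv ModularForm.eta z := by
    rw [← h2]
    field_simp
  rw [h3]
  exact h

lemma e2_T {z : ℂ} (hz : 0 < z.im) : e2 (z + 1) = e2 z := by
  have := congrFun (E2_slash_action ModularGroup.T) ⟨z, hz⟩
  rw [D2_T, SL_slash_apply, modular_T_smul, ModularGroup.denom_apply] at this
  simp [ModularGroup.T] at this
  rw [← e2_coe, ← e2_coe] at this
  simpa [add_comm] using this

lemma e2_S {z : ℂ} (hz : 0 < z.im) : e2 (-1 / z) = z ^ 2 * e2 z + 6 * z / (π * I) := by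
  have := congrFun (E2_slash_action ModularGroup.S) ⟨z, hz⟩
  rw [SlashInvariantForm.slash_S_apply, Pi.sub_apply, Pi.smul_apply, D2_S, ← e2_coe, ← e2_coe, riemannZeta_two] at this
  change e2 (-z)⁻¹ * z ^ (-2 : ℤ) = e2 z - (1 / (2 * (π ^ 2 / 6)) : ℂ) * (2 * π * I / z) at this
  have hz0 : z ≠ 0 := by rintro rfl; simp at hz
  have e : -1 / z = (-z)⁻¹ := by rw [inv_neg, neg_div, one_div]
  have hpi : (π : ℂ) ≠ 0 := by exact_mod_cast Real.pi_ne_zero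
  rw [e, ← mul_left_inj' (zpow_ne_zero (-2) hz0), this]
  rw [zpow_neg, zpow_ofNat]
  field_simp
  ring_nf
  simp [I_sq]
  try ring

lemma e2_infty : Tendsto e2 infty (𝓝 1) := by
  set c : ℕ → ℂ := fun m => if m = 0 then 1 else -24 * ArithmeticFunction.sigma 1 m with hc
  have h1 : ∀ z : ℂ, 0 < z.im → HasSum (fun m : ℕ => c m * cexp (2 * π * I * z) ^ m) (e2 z) := by
    intro z hz
    have := hasSum_qExpansion_E2 (z := ⟨z, hz⟩)
    rw [← e2_coe] at this
    exact this
  have hsum : Summable fun m : ℕ => ‖c m * cexp (2 * π * I * I) ^ m‖ :=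
    (h1 I (by simp)).summable.norm
  have hlim := tendsto_tsum_of_dominated_convergence (𝓕 := infty)
    (f := fun (z : ℂ) (m : ℕ) => c m * cexp (2 * π * I * z) ^ m)
    (g := fun m => if m = 0 then 1 else 0) hsum ?_ ?_
  · rw [tsum_ite_eq] at hlim
    refine hlim.congr' ?_
    filter_upwards [HH_mem_infty] with z hz using (h1 z hz).tsum_eq
  · intro m
    rcases Nat.eq_zero_or_pos m with rfl | hm
    · simp [hc]
    · have h := (tendsto_q_infty.pow m).const_mul (c m)
      rw [zero_pow hm.ne', mul_zero] at h
      simpa [hm.ne'] using h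
  · have : {z : ℂ | 1 ≤ z.im} ∈ infty := ⟨Set.Ici 1, Ici_mem_atTop 1, fun z hz => hz⟩
    filter_upwards [this] with z hz m
    rw [norm_mul, norm_mul, norm_pow, norm_pow]
    gcongr
    rw [Complex.norm_exp, Complex.norm_exp]
    simp
    change 1 ≤ z.im at hz
    nlinarith [Real.pi_pos]

/-- Derivatives of functions with a limit at `i∞` tend to zero. -/
lemma deriv_infty {f : ℂ → ℂ} {c : ℂ} (hd : DifferentiableOn ℂ f HH) (h : Tendsto f infty (𝓝 c)) :
    Tendsto (deriv f) infty (𝓝 0) := by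
  rw [Metric.tendsto_nhds] at h ⊢
  intro ε hε
  have h1 := h (ε / 2) (by positivity)
  obtain ⟨t, ht, hts⟩ := h1
  obtain ⟨a, ha⟩ := mem_atTop_sets.mp ht
  refine ⟨Set.Ici (max a 1 + 2), Ici_mem_atTop _, fun z hz => ?_⟩
  change max a 1 + 2 ≤ z.im at hz
  have hball : ∀ w ∈ Metric.closedBall z 1, max a 1 ≤ w.im := by
    intro w hw
    have h3 := Complex.abs_im_le_norm (w - z)
    rw [Metric.mem_closedBall, dist_eq_norm] at hw
    have := (abs_le.mp (h3.trans hw)).1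
    simp at this
    linarith
  have hdc : DiffContOnCl ℂ (fun w => f w - c) (Metric.ball z 1) := by
    apply DifferentiableOn.diffContOnCl
    rw [closure_ball _ one_ne_zero]
    refine (hd.mono fun w hw => ?_).sub_const c
    have := hball w hw
    change 0 < w.im
    linarith [le_max_right a 1]
  have hle := Complex.norm_deriv_le_of_forall_mem_sphere_norm_le (C := ε / 2) one_pos hdc (by
    intro w hw
    have := hts (ha w.im ((le_max_left a 1).trans (hball w (Metric.sphere_subset_closedBall hw))))
    change dist (f w) c < ε / 2 at this
    rw [dist_eq_norm] at this
    exact this.le)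
  rw [deriv_sub_const] at hle
  change dist _ _ < _
  rw [dist_zero_right]
  linarith

end Sig4
end

section
open Filter Topology ModularForm EisensteinSeries
open UpperHalfPlane hiding I
open scoped Real MatrixGroups Manifold
namespace Sig4


/-! ### Theta functions -/

/-- the function `Θ(z/2, z)` -/
def jj (z : ℂ) : ℂ := jacobiTheta₂ (z / 2) z
def v3 (z : ℂ) : ℂ := jacobiTheta₂ 0 z
def v4 (z : ℂ) : ℂ := jacobiTheta₂ (1 / 2) z
def v2 (z : ℂ) : ℂ := cexp (π * I * z / 4) * jj z
def t2 (z : ℂ) : ℂ := v2 z ^ 4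
def t3 (z : ℂ) : ℂ := v3 z ^ 4
def t4 (z : ℂ) : ℂ := v4 z ^ 4

lemma t2_eq (z : ℂ) : t2 z = cexp (π * I * z) * jj z ^ 4 := by
  rw [t2, v2, mul_pow, ← Complex.exp_nat_mul]
  congr 2
  push_cast
  ring

lemma jj_diff : DifferentiableOn ℂ jj HH := by
  intro z hz
  apply DifferentiableAt.differentiableWithinAt
  have h := (hasFDerivAt_jacobiTheta₂ (z / 2) (τ := z) hz).differentiableAt
  have h2 : DifferentiableAt ℂ (fun w : ℂ => (w / 2, w)) z := by fun_prop
  exact DifferentiableAt.comp (g := fun p : ℂ × ℂ => jacobiTheta₂ p.1 p.2)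
    (f := fun w : ℂ => (w / 2, w)) z h h2

lemma t2_diff : DifferentiableOn ℂ t2 HH := by
  have := jj_diff
  have h : DifferentiableOn ℂ (fun z : ℂ => cexp (π * I * z / 4)) HH := by fun_prop
  exact (h.mul this).pow 4

lemma t3_diff : DifferentiableOn ℂ t3 HH := by
  refine DifferentiableOn.pow (fun z hz => ?_) 4
  exact (differentiableAt_jacobiTheta₂_snd 0 hz).differentiableWithinAt

lemma t4_diff : DifferentiableOn ℂ t4 HH := by
  refine DifferentiableOn.pow (fun z hz => ?_) 4
  exact (differentiableAt_jacobiTheta₂_snd (1 / 2) hz).differentiableWithinAt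

/-- limit at infinity of a series of exponentials -/
lemma series_infty (u : ℤ → ℂ) (a : ℤ → ℝ) (ha : ∀ n, 0 ≤ a n)
    (hs : Summable fun n => u n * cexp (a n * π * I * I)) :
    Tendsto (fun z : ℂ => ∑' n : ℤ, u n * cexp (a n * π * I * z)) infty
      (𝓝 (∑' n : ℤ, if a n = 0 then u n else 0)) := by
  refine tendsto_tsum_of_dominated_convergence hs.norm ?_ ?_
  · intro n
    by_cases h : a n = 0
    · simp [h]
    · have h1 : 0 < a n * π := mul_pos (lt_of_le_of_ne (ha n) (Ne.symm h)) Real.pi_pos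
      have h2 := (tendsto_exp_infty h1).const_mul (u n)
      rw [mul_zero] at h2
      push_cast at h2
      simpa [h] using h2
  · have : {z : ℂ | 1 ≤ z.im} ∈ infty := ⟨Set.Ici 1, Ici_mem_atTop 1, fun z hz => hz⟩
    filter_upwards [this] with z hz n
    rw [norm_mul, norm_mul]
    gcongr
    rw [Complex.norm_exp, Complex.norm_exp]
    simp
    change 1 ≤ z.im at hz
    have h1 : 0 ≤ a n * π := mul_nonneg (ha n) Real.pi_pos.le
    nlinarith

lemma jj_infty : Tendsto jj infty (𝓝 2) := by
  have key : ∀ z : ℂ, ∀ n : ℤ, jacobiTheta₂_term n (z / 2) z =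
      1 * cexp (((n * (n + 1) : ℤ) : ℝ) * π * I * z) := by
    intro z n
    rw [jacobiTheta₂_term, one_mul]
    congr 1
    push_cast
    ring
  have h := series_infty (fun _ => 1) (fun n => ((n * (n + 1) : ℤ) : ℝ)) (by
    intro n
    have : 0 ≤ n * (n + 1) := by
      rcases le_or_gt 0 n with h | h
      · positivity
      · nlinarith
    exact_mod_cast this) (by
    have := (hasSum_jacobiTheta₂_term (I / 2) (τ := I) (by simp)).summable
    exact this.congr (fun n => by rw [key]))
  have e : (∑' n : ℤ, if (((n * (n + 1) : ℤ) : ℝ)) = 0 then (1 : ℂ) else 0) = 2 := by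
    rw [tsum_eq_sum (s := {0, -1})]
    · rw [Finset.sum_pair (by norm_num)]; norm_num
    · intro n hn
      have : ¬ (((n * (n + 1) : ℤ) : ℝ)) = 0 := by
        norm_cast
        intro h
        rcases mul_eq_zero.mp h with h | h
        · simp [h] at hn
        · have : n = -1 := by omega
          simp [this] at hn
      rw [if_neg this]
  rw [e] at h
  refine h.congr fun z => ?_
  rw [jj, jacobiTheta₂]
  exact tsum_congr fun n => (key z n).symm

lemma vc_infty (c : ℝ) : Tendsto (fun z => jacobiTheta₂ c z) infty (𝓝 1) := by
  have key : ∀ z : ℂ, ∀ n : ℤ, jacobiTheta₂_term n c z =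
      cexp ((2 * π * n * c : ℝ) * I) * cexp (((n ^ 2 : ℤ) : ℝ) * π * I * z) := by
    intro z n
    rw [jacobiTheta₂_term, ← Complex.exp_add]
    congr 1
    push_cast
    ring
  have h := series_infty (fun n => cexp ((2 * π * n * c : ℝ) * I)) (fun n => ((n ^ 2 : ℤ) : ℝ))
    (by
    intro n
    push_cast
    positivity) (by
    have := (hasSum_jacobiTheta₂_term c (τ := I) (by simp)).summable
    exact this.congr (fun n => by rw [key]))
  have e : (∑' n : ℤ, if (((n ^ 2 : ℤ) : ℝ)) = 0 then cexp ((2 * π * n * c : ℝ) * I) else 0) = 1 := by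
    rw [tsum_eq_sum (s := {0})]
    · simp
    · intro n hn
      simp at hn
      simp [hn]
  rw [e] at h
  refine h.congr fun z => ?_
  rw [jacobiTheta₂]
  exact tsum_congr fun n => (key z n).symm

lemma t3_infty : Tendsto t3 infty (𝓝 1) := by
  have := (vc_infty 0).pow 4
  simp only [ofReal_zero, one_pow] at this
  exact this

lemma t4_infty : Tendsto t4 infty (𝓝 1) := by
  have := (vc_infty (1 / 2)).pow 4
  push_cast at this
  rw [one_pow] at this
  exact this

lemma t2_infty : Tendsto t2 infty (𝓝 0) := by
  have := (tendsto_exp_infty Real.pi_pos).mul (jj_infty.pow 4)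
  rw [zero_mul] at this
  exact this.congr fun z => (t2_eq z).symm

/-! ### transformations -/

lemma v3_T (z : ℂ) : v3 (z + 1) = v4 z := by
  refine tsum_congr fun n => ?_
  rw [jacobiTheta₂_term, jacobiTheta₂_term, Complex.exp_eq_exp_iff_exists_int]
  obtain ⟨k, hk⟩ := Int.even_mul_pred_self n
  refine ⟨k, ?_⟩
  have hk' : (n : ℂ) * (n - 1) = k + k := by exact_mod_cast hk
  linear_combination (π * I) * hk'

lemma v4_T (z : ℂ) : v4 (z + 1) = v3 z := by
  refine tsum_congr fun n => ?_
  rw [jacobiTheta₂_term, jacobiTheta₂_term, Complex.exp_eq_exp_iff_exists_int]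
  obtain ⟨k, hk⟩ := Int.even_mul_succ_self n
  refine ⟨k, ?_⟩
  have hk' : (n : ℂ) * (n + 1) = k + k := by exact_mod_cast hk
  linear_combination (π * I) * hk'

lemma jj_T (z : ℂ) : jj (z + 1) = jj z := by
  refine tsum_congr fun n => ?_
  rw [jacobiTheta₂_term, jacobiTheta₂_term, Complex.exp_eq_exp_iff_exists_int]
  obtain ⟨k, hk⟩ := Int.even_mul_succ_self n
  refine ⟨k, ?_⟩
  have hk' : (n : ℂ) * (n + 1) = k + k := by exact_mod_cast hk
  linear_combination (π * I) * hk'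

lemma t3_T (z : ℂ) : t3 (z + 1) = t4 z := by rw [t3, v3_T, t4]
lemma t4_T (z : ℂ) : t4 (z + 1) = t3 z := by rw [t4, v4_T, t3]
lemma t2_T (z : ℂ) : t2 (z + 1) = - t2 z := by
  rw [t2_eq, t2_eq, jj_T, mul_add, Complex.exp_add, mul_one, Complex.exp_pi_mul_I]
  ring

lemma root_pow (z : ℂ) : ((-I * z) ^ (1 / 2 : ℂ)) ^ 4 = - z ^ 2 := by
  have h : ((-I * z) ^ (1 / 2 : ℂ)) ^ 2 = -I * z := by
    rw [← Complex.cpow_nat_mul]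
    norm_num
  calc ((-I * z) ^ (1 / 2 : ℂ)) ^ 4 = (((-I * z) ^ (1 / 2 : ℂ)) ^ 2) ^ 2 := by ring
    _ = - z ^ 2 := by rw [h, mul_pow, neg_sq, I_sq]; ring

lemma aux_S {z a b : ℂ} (hz : z ≠ 0) (h : a = 1 / (-I * z) ^ (1 / 2 : ℂ) * b) :
    b ^ 4 = - z ^ 2 * a ^ 4 := by
  have h1 := root_pow z
  rw [h, mul_pow, div_pow, one_pow, h1]
  field_simp

lemma t3_S {z : ℂ} (hz : 0 < z.im) : t3 (-1 / z) = - z ^ 2 * t3 z := by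
  have hz0 : z ≠ 0 := by rintro rfl; simp at hz
  apply aux_S hz0
  rw [v3, jacobiTheta₂_functional_equation]
  simp [v3]

lemma t4_S' {z : ℂ} (hz : 0 < z.im) : t2 (-1 / z) = - z ^ 2 * t4 z := by
  have hz0 : z ≠ 0 := by rintro rfl; simp at hz
  apply aux_S hz0
  rw [v4, jacobiTheta₂_functional_equation, v2, jj, mul_assoc]
  congr 2
  · congr 1
    field_simp
    try ring
  · rw [← jacobiTheta₂_neg_left]
    congr 1
    field_simp

lemma t2_S {z : ℂ} (hz : 0 < z.im) : t2 (-1 / z) = - z ^ 2 * t4 z := t4_S' hz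

lemma t4_S {z : ℂ} (hz : 0 < z.im) : t4 (-1 / z) = - z ^ 2 * t2 z := by
  have hz0 : z ≠ 0 := by rintro rfl; simp at hz
  have h := t2_S (neg_inv_mem hz)
  have e : -1 / (-1 / z) = z := by field_simp
  rw [e] at h
  rw [h]
  field_simp

end Sig4
end

section
open Filter Topology ModularForm EisensteinSeries
open UpperHalfPlane hiding I
open scoped Real MatrixGroups Manifold
namespace Sig4


/-! ### duplication -/

/-- parity decomposition of the lattice -/
def par : (ℤ × ℤ) ⊕ (ℤ × ℤ) → ℤ × ℤ :=
  Sum.elim (fun p => (p.1 + p.2, p.1 - p.2)) (fun p => (p.1 + p.2 + 1, p.1 - p.2))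

lemma par_bij : Function.Bijective par := by
  constructor
  · rintro (⟨a, b⟩ | ⟨a, b⟩) (⟨c, d⟩ | ⟨c, d⟩) h <;>
      simp only [par, Sum.elim_inl, Sum.elim_inr, Prod.mk.injEq] at h
    · have h1 : a = c := by omega
      have h2 : b = d := by omega
      rw [h1, h2]
    · omega
    · omega
    · have h1 : a = c := by omega
      have h2 : b = d := by omega
      rw [h1, h2]
  · rintro ⟨m, n⟩
    rcases Int.even_or_odd' (m + n) with ⟨k, hk | hk⟩
    · refine ⟨Sum.inl (k, m - k), ?_⟩
      simp only [par, Sum.elim_inl, Prod.mk.injEq]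
      omega
    · refine ⟨Sum.inr (k, m - k - 1), ?_⟩
      simp only [par, Sum.elim_inr, Prod.mk.injEq]
      omega

lemma tsum_par (F : ℤ × ℤ → ℂ) (hF : Summable F) :
    ∑' p, F p = ∑' p : ℤ × ℤ, F (p.1 + p.2, p.1 - p.2)
      + ∑' p : ℤ × ℤ, F (p.1 + p.2 + 1, p.1 - p.2) := by
  have h := (Equiv.ofBijective par par_bij).tsum_eq F
  have hs : Summable (F ∘ par) := (Equiv.ofBijective par par_bij).summable_iff.mpr hF
  rw [← h]
  have h1 : Summable ((F ∘ par) ∘ Sum.inl) := hs.comp_injective Sum.inl_injective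
  have h2 : Summable ((F ∘ par) ∘ Sum.inr) := hs.comp_injective Sum.inr_injective
  exact Summable.tsum_sum (f := F ∘ par) h1 h2

lemma sq_tsum {f : ℤ → ℂ} (hf : Summable f) :
    (∑' n, f n) ^ 2 = ∑' p : ℤ × ℤ, f p.1 * f p.2 := by
  rw [sq, tsum_mul_tsum_of_summable_norm hf.norm hf.norm]

lemma v2_two (z : ℂ) : v2 (2 * z) = ∑' n : ℤ, cexp (2 * π * I * z * ((n : ℂ) + 1 / 2) ^ 2) := by
  rw [v2, jj, jacobiTheta₂, ← tsum_mul_left]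
  refine tsum_congr fun n => ?_
  rw [jacobiTheta₂_term, ← Complex.exp_add]
  congr 1
  ring

lemma v3_two (z : ℂ) : v3 (2 * z) = ∑' n : ℤ, cexp (2 * π * I * z * (n : ℂ) ^ 2) := by
  rw [v3, jacobiTheta₂]
  refine tsum_congr fun n => ?_
  rw [jacobiTheta₂_term]
  congr 1
  ring

lemma two_im {z : ℂ} (hz : 0 < z.im) : 0 < (2 * z).im := by simpa using hz

lemma v3_two_summable {z : ℂ} (hz : 0 < z.im) :
    Summable fun n : ℤ => cexp (2 * π * I * z * (n : ℂ) ^ 2) := by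
  refine (hasSum_jacobiTheta₂_term 0 (two_im hz)).summable.congr fun n => ?_
  rw [jacobiTheta₂_term]
  congr 1
  ring

lemma v2_two_summable {z : ℂ} (hz : 0 < z.im) :
    Summable fun n : ℤ => cexp (2 * π * I * z * ((n : ℂ) + 1 / 2) ^ 2) := by
  refine ((hasSum_jacobiTheta₂_term (2 * z / 2) (two_im hz)).summable.mul_left
    (cexp (π * I * (2 * z) / 4))).congr fun n => ?_
  rw [jacobiTheta₂_term, ← Complex.exp_add]
  congr 1
  ring

lemma dup3 {z : ℂ} (hz : 0 < z.im) : v3 z ^ 2 = v3 (2 * z) ^ 2 + v2 (2 * z) ^ 2 := by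
  have hs := (hasSum_jacobiTheta₂_term 0 hz).summable
  rw [v3, jacobiTheta₂, sq_tsum hs, tsum_par _ (summable_mul_of_summable_norm hs.norm hs.norm),
    v3_two, v2_two, sq_tsum (v3_two_summable hz), sq_tsum (v2_two_summable hz)]
  congr 1
  · refine tsum_congr fun p => ?_
    simp only [jacobiTheta₂_term, ← Complex.exp_add]
    congr 1
    push_cast
    ring
  · refine tsum_congr fun p => ?_
    simp only [jacobiTheta₂_term, ← Complex.exp_add]
    congr 1
    push_cast
    ring

lemma dup4 {z : ℂ} (hz : 0 < z.im) : v4 z ^ 2 = v3 (2 * z) ^ 2 - v2 (2 * z) ^ 2 := by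
  have hs := (hasSum_jacobiTheta₂_term (1 / 2) hz).summable
  rw [v4, jacobiTheta₂, sq_tsum hs, tsum_par _ (summable_mul_of_summable_norm hs.norm hs.norm),
    v3_two, v2_two, sq_tsum (v3_two_summable hz), sq_tsum (v2_two_summable hz), sub_eq_add_neg,
    ← tsum_neg]
  congr 1
  · refine tsum_congr fun p => ?_
    simp only [jacobiTheta₂_term, ← Complex.exp_add]
    rw [Complex.exp_eq_exp_iff_exists_int]
    refine ⟨p.1, ?_⟩
    push_cast
    ring
  · refine tsum_congr fun p => ?_
    rw [neg_eq_neg_one_mul, ← Complex.exp_pi_mul_I]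
    simp only [jacobiTheta₂_term, ← Complex.exp_add]
    rw [Complex.exp_eq_exp_iff_exists_int]
    refine ⟨p.1, ?_⟩
    push_cast
    ring

/-! ### The Jacobi quartic identity -/

lemma jacobi {z : ℂ} (hz : 0 < z.im) : t3 z = t2 z + t4 z := by
  have := cusp_zero 4 (by norm_num) (fun z => (t3 z - t2 z - t4 z) ^ 2)
    (((t3_diff.sub t2_diff).sub t4_diff).pow 2)
    (by intro w hw; simp only [t3_T, t2_T, t4_T]; ring)
    (by
      intro w hw
      simp only [t3_S hw, t2_S hw, t4_S hw]
      norm_cast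
      ring)
    (by simpa using ((t3_infty.sub t2_infty).sub t4_infty).pow 2) z hz
  have h : t3 z - t2 z - t4 z = 0 := by simpa using this
  linear_combination h

/-! ### Ramanujan -/

lemma differentiableAt_of {f : ℂ → ℂ} (h : DifferentiableOn ℂ f HH) {z : ℂ} (hz : 0 < z.im) :
    DifferentiableAt ℂ f z := h.differentiableAt (isOpen_HH.mem_nhds hz)

lemma HH_nhds {z : ℂ} (hz : 0 < z.im) : ∀ᶠ w in 𝓝 z, 0 < w.im := isOpen_HH.mem_nhds hz

lemma de2_T {z : ℂ} (hz : 0 < z.im) : deriv e2 (z + 1) = deriv e2 z := by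
  rw [← deriv_comp_add_const]
  apply Filter.EventuallyEq.deriv_eq
  filter_upwards [HH_nhds hz] with w hw using e2_T hw

lemma de2_S {z : ℂ} (hz : 0 < z.im) :
    deriv e2 (-1 / z) = z ^ 2 * (z ^ 2 * deriv e2 z + 2 * z * e2 z + 6 / (π * I)) := by
  have hz0 : z ≠ 0 := by rintro rfl; simp at hz
  have h1 : HasDerivAt (fun w : ℂ => e2 (-1 / w)) (deriv e2 (-1 / z) * (1 / z ^ 2)) z := by
    have ha := (differentiableAt_of e2_diff (neg_inv_mem hz)).hasDerivAt
    have hb : HasDerivAt (fun w : ℂ => -1 / w) (1 / z ^ 2) z := by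
      have := (hasDerivAt_inv hz0).neg
      have e : (fun w : ℂ => -1 / w) = -(fun y : ℂ => y⁻¹) := by
        funext w
        simp only [Pi.neg_apply]
        rw [neg_div, one_div]
      rw [e]
      refine HasDerivAt.congr_deriv this ?_
      rw [neg_neg, one_div]
    exact HasDerivAt.comp z ha hb
  have h2 : HasDerivAt (fun w : ℂ => w ^ 2 * e2 w + 6 * w / (π * I))
      (2 * z * e2 z + z ^ 2 * deriv e2 z + 6 / (π * I)) z := by
    have ha := (differentiableAt_of e2_diff hz).hasDerivAt
    have hb := ((hasDerivAt_pow 2 z).mul ha).add (((hasDerivAt_id z).const_mul 6).div_const (π * I))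
    have e : (fun w : ℂ => w ^ 2 * e2 w + 6 * w / (π * I)) =
        ((fun x : ℂ => x ^ 2) * e2 + fun x : ℂ => 6 * id x / (π * I)) := by
      funext w
      rfl
    rw [e]
    refine HasDerivAt.congr_deriv hb ?_
    norm_num
  have h3 := h1.unique (h2.congr_of_eventuallyEq (by
    filter_upwards [HH_nhds hz] with w hw using e2_S hw))
  field_simp at h3
  field_simp
  linear_combination h3

lemma ramanujan {z : ℂ} (hz : 0 < z.im) :
    12 * ((2 * π * I)⁻¹ * deriv e2 z) = e2 z ^ 2 - (t2 z ^ 2 + t3 z ^ 2 + t4 z ^ 2) / 2 := by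
  have hdd : DifferentiableOn ℂ (deriv e2) HH := e2_diff.deriv isOpen_HH
  have hpi : (π : ℂ) ≠ 0 := by exact_mod_cast Real.pi_ne_zero
  have := cusp_zero 4 (by norm_num)
    (fun z => 12 * ((2 * π * I)⁻¹ * deriv e2 z) - (e2 z ^ 2 - (t2 z ^ 2 + t3 z ^ 2 + t4 z ^ 2) / 2))
    (((hdd.const_mul _).const_mul _).sub ((e2_diff.pow 2).sub
      ((((t2_diff.pow 2).add (t3_diff.pow 2)).add (t4_diff.pow 2)).div_const 2)))
    (by intro w hw; simp only [t3_T, t2_T, t4_T, e2_T hw, de2_T hw]; ring)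
    (by
      intro w hw
      simp only [t3_S hw, t2_S hw, t4_S hw, e2_S hw, de2_S hw]
      rw [show w ^ (4 : ℤ) = w ^ 4 by norm_cast]
      field_simp
      ring_nf
      try ring)
    (by
      have := ((((deriv_infty e2_diff e2_infty).const_mul (2 * π * I)⁻¹).const_mul 12)).sub
        ((e2_infty.pow 2).sub
        ((((t2_infty.pow 2).add (t3_infty.pow 2)).add (t4_infty.pow 2)).div_const 2))
      norm_num at this
      simpa using this) z hz
  linear_combination this

/-! ### weight two -/

def a1 (z : ℂ) : ℂ := (t3 z + t4 z) / 2 - 2 * e2 (2 * z) + e2 z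
def a2 (z : ℂ) : ℂ := -(t3 z + t2 z) / 2 - e2 (z / 2) / 2 + e2 z
def a3 (z : ℂ) : ℂ := (t2 z - t4 z) / 2 - e2 ((z + 1) / 2) / 2 + e2 z

lemma half_im {z : ℂ} (hz : 0 < z.im) : 0 < (z / 2).im := by simpa using hz
lemma half_im' {z : ℂ} (hz : 0 < z.im) : 0 < ((z + 1) / 2).im := by simpa using hz

lemma a1_T {z : ℂ} (hz : 0 < z.im) : a1 (z + 1) = a1 z := by
  have e : 2 * (z + 1) = 2 * z + 1 + 1 := by ring
  have h : 0 < (2 * z + 1).im := by simpa using hz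
  simp only [a1, t3_T, t4_T, e, e2_T hz, e2_T h, e2_T (two_im hz)]
  ring

lemma a2_T {z : ℂ} (hz : 0 < z.im) : a2 (z + 1) = a3 z := by
  simp only [a2, a3, t3_T, t2_T, e2_T hz]
  ring

lemma a3_T {z : ℂ} (hz : 0 < z.im) : a3 (z + 1) = a2 z := by
  have e : (z + 1 + 1) / 2 = z / 2 + 1 := by ring
  simp only [a2, a3, t4_T, t2_T, e2_T hz, e, e2_T (half_im hz)]
  ring

lemma a1_S {z : ℂ} (hz : 0 < z.im) : a1 (-1 / z) = z ^ 2 * a2 z := by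
  have e : 2 * (-1 / z) = -1 / (z / 2) := by field_simp
  simp only [a1, a2, t3_S hz, t4_S hz, e, e2_S hz, e2_S (half_im hz)]
  ring

lemma a2_S {z : ℂ} (hz : 0 < z.im) : a2 (-1 / z) = z ^ 2 * a1 z := by
  have e : (-1 / z) / 2 = -1 / (2 * z) := by field_simp
  simp only [a1, a2, t3_S hz, t2_S hz, e, e2_S hz, e2_S (two_im hz)]
  ring

lemma e2_a3 {z : ℂ} (hz : 0 < z.im) :
    e2 ((-1 / z + 1) / 2) = z ^ 2 * e2 ((z + 1) / 2) + 12 * z / (π * I) := by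
  have hz0 : z ≠ 0 := by rintro rfl; simp at hz
  have hz1 : z - 1 ≠ 0 := by
    intro h
    have := congrArg Complex.im h
    simp at this
    linarith
  set u := (z - 1) / 2 with hu
  have hu0 : u ≠ 0 := by rw [hu]; exact div_ne_zero hz1 two_ne_zero
  have hui : 0 < u.im := by rw [hu]; simpa using hz
  set v := -1 / u - 2 with hv
  have hvi : 0 < v.im := by rw [hv]; simpa using neg_inv_mem hui
  have hvi1 : 0 < (v + 1).im := by simpa using hvi
  have hvz : v = -z / u := by rw [hv, hu]; field_simp; ring
  have h1 : e2 v = e2 (-1 / u) := by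
    rw [← e2_T hvi, ← e2_T hvi1, hv]
    congr 1
    ring
  have h2 : e2 ((z + 1) / 2) = e2 u := by
    rw [← e2_T hui, hu]
    congr 1
    ring
  have h3 : (-1 / z + 1) / 2 = -1 / v := by
    rw [hvz, hu]
    field_simp
    ring
  have hpi : (π : ℂ) ≠ 0 := by exact_mod_cast Real.pi_ne_zero
  rw [h3, e2_S hvi, h1, e2_S hui, h2, hvz]
  field_simp
  rw [hu]
  ring

lemma a3_S {z : ℂ} (hz : 0 < z.im) : a3 (-1 / z) = z ^ 2 * a3 z := by
  simp only [a3, t4_S hz, t2_S hz, e2_S hz, e2_a3 hz]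
  ring

lemma e2_two_diff : DifferentiableOn ℂ (fun z => e2 (2 * z)) HH :=
  e2_diff.comp (by fun_prop) fun z hz => two_im hz

lemma a1_diff : DifferentiableOn ℂ a1 HH :=
  (((t3_diff.add t4_diff).div_const 2).sub (e2_two_diff.const_mul 2)).add e2_diff

lemma a2_diff : DifferentiableOn ℂ a2 HH := by
  have h : DifferentiableOn ℂ (fun z => e2 (z / 2)) HH :=
    e2_diff.comp (by fun_prop) fun z hz => half_im hz
  exact (((t3_diff.add t2_diff).neg.div_const 2).sub (h.div_const 2)).add e2_diff

lemma a3_diff : DifferentiableOn ℂ a3 HH := by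
  have h : DifferentiableOn ℂ (fun z => e2 ((z + 1) / 2)) HH :=
    e2_diff.comp (by fun_prop) fun z hz => half_im' hz
  exact (((t2_diff.sub t4_diff).div_const 2).sub (h.div_const 2)).add e2_diff

lemma a1_infty : Tendsto a1 infty (𝓝 0) := by
  have := (((t3_infty.add t4_infty).div_const 2).sub
    ((e2_infty.comp tendsto_two_mul).const_mul 2)).add e2_infty
  norm_num at this
  exact this

lemma a2_infty : Tendsto a2 infty (𝓝 0) := by
  have h := e2_infty.comp (tendsto_half 0)
  have := (((t3_infty.add t2_infty).neg.div_const 2).sub (h.div_const 2)).add e2_infty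
  norm_num at this
  refine this.congr fun z => ?_
  simp [a2]

lemma a3_infty : Tendsto a3 infty (𝓝 0) := by
  have h := e2_infty.comp (tendsto_half 1)
  have := (((t2_infty.sub t4_infty).div_const 2).sub (h.div_const 2)).add e2_infty
  norm_num at this
  refine this.congr fun z => ?_
  simp [a3]

lemma weight_two {z : ℂ} (hz : 0 < z.im) : (t3 z + t4 z) / 2 = 2 * e2 (2 * z) - e2 z := by
  have h1 := cusp_zero 2 (by norm_num) (fun z => a1 z + a2 z + a3 z)
    ((a1_diff.add a2_diff).add a3_diff)
    (by intro w hw; simp only [a1_T hw, a2_T hw, a3_T hw]; ring)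
    (by intro w hw; simp only [a1_S hw, a2_S hw, a3_S hw]; norm_cast; ring)
    (by simpa using (a1_infty.add a2_infty).add a3_infty) z hz
  have h2 := cusp_zero 4 (by norm_num) (fun z => a1 z * a2 z + a2 z * a3 z + a3 z * a1 z)
    (((a1_diff.mul a2_diff).add (a2_diff.mul a3_diff)).add (a3_diff.mul a1_diff))
    (by intro w hw; simp only [a1_T hw, a2_T hw, a3_T hw]; ring)
    (by intro w hw; simp only [a1_S hw, a2_S hw, a3_S hw]; norm_cast; ring)
    (by simpa using ((a1_infty.mul a2_infty).add (a2_infty.mul a3_infty)).add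
          (a3_infty.mul a1_infty)) z hz
  have h3 := cusp_zero 6 (by norm_num) (fun z => a1 z * a2 z * a3 z)
    ((a1_diff.mul a2_diff).mul a3_diff)
    (by intro w hw; simp only [a1_T hw, a2_T hw, a3_T hw]; ring)
    (by intro w hw; simp only [a1_S hw, a2_S hw, a3_S hw]; norm_cast; ring)
    (by simpa using (a1_infty.mul a2_infty).mul a3_infty) z hz
  have h4 : a1 z ^ 3 = 0 := by
    linear_combination a1 z ^ 2 * h1 - a1 z * h2 + h3
  have h5 : a1 z = 0 := by simpa using h4
  rw [a1] at h5
  linear_combination h5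

end Sig4
end

section
open Filter Topology ModularForm EisensteinSeries
open UpperHalfPlane hiding I
open scoped Real MatrixGroups Manifold
namespace Sig4


lemma eta_pow (z : ℂ) : ModularForm.eta z ^ 24 =
    cexp (2 * π * I * z) * euler (cexp (2 * π * I * z)) ^ 24 := by
  rw [eta_euler, mul_pow, ← Complex.exp_nat_mul]
  congr 2
  push_cast
  ring

lemma t2_sq (z : ℂ) : t2 z ^ 2 = cexp (2 * π * I * z) * jj z ^ 8 := by
  rw [t2_eq, mul_pow, ← Complex.exp_nat_mul, ← pow_mul]
  congr 2
  push_cast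
  ring

lemma triple {z : ℂ} (hz : 0 < z.im) :
    (t2 z * t3 z * t4 z) ^ 2 = 256 * ModularForm.eta z ^ 24 := by
  obtain ⟨c, hc⟩ := cusp_twelve (fun z => (t2 z * t3 z * t4 z) ^ 2)
    (((t2_diff.mul t3_diff).mul t4_diff).pow 2)
    (by intro w hw; simp only [t3_T, t2_T, t4_T]; ring)
    (by
      intro w hw
      simp only [t3_S hw, t2_S hw, t4_S hw]
      rw [show w ^ (12 : ℤ) = w ^ 12 by norm_cast]
      ring)
    (by simpa using ((t2_infty.mul t3_infty).mul t4_infty).pow 2)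
  have h1 : Tendsto (fun z => jj z ^ 8 * (t3 z * t4 z) ^ 2) infty (𝓝 256) := by
    have := (jj_infty.pow 8).mul ((t3_infty.mul t4_infty).pow 2)
    norm_num at this
    exact this
  have h2 : Tendsto (fun z => c * euler (cexp (2 * π * I * z)) ^ 24) infty (𝓝 c) := by
    simpa using (euler_infty.pow 24).const_mul c
  have h3 : c = 256 := by
    refine tendsto_nhds_unique h2 (h1.congr' ?_)
    filter_upwards [HH_mem_infty] with w hw
    have h := hc w hw
    rw [eta_pow] at h
    have e : (t2 w * t3 w * t4 w) ^ 2 = cexp (2 * π * I * w) * (jj w ^ 8 * (t3 w * t4 w) ^ 2) := by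
      rw [mul_assoc, mul_pow, t2_sq]
      ring
    apply mul_left_cancel₀ (Complex.exp_ne_zero (2 * π * I * w))
    linear_combination h - e
  rw [← h3]
  exact hc z hz

lemma t3_two {z : ℂ} (hz : 0 < z.im) : t3 (2 * z) = ((v3 z ^ 2 + v4 z ^ 2) / 2) ^ 2 := by
  rw [dup3 hz, dup4 hz, t3]
  ring

lemma t2_two {z : ℂ} (hz : 0 < z.im) : t2 (2 * z) = ((v3 z ^ 2 - v4 z ^ 2) / 2) ^ 2 := by
  rw [dup3 hz, dup4 hz, t2]
  ring

lemma t4_two {z : ℂ} (hz : 0 < z.im) : t4 (2 * z) = v3 z ^ 2 * v4 z ^ 2 := by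
  have h := jacobi (two_im hz)
  rw [t3_two hz, t2_two hz] at h
  linear_combination -h

lemma triple_two {z : ℂ} (hz : 0 < z.im) :
    t2 z ^ 4 * (t3 z * t4 z) = 2 ^ 16 * ModularForm.eta (2 * z) ^ 24 := by
  have h := triple (two_im hz)
  rw [t3_two hz, t2_two hz, t4_two hz] at h
  have hj := jacobi hz
  have e : t2 z = v3 z ^ 4 - v4 z ^ 4 := by
    rw [t3, t4] at hj
    linear_combination -hj
  rw [e, t3, t4]
  linear_combination 256 * h

lemma six {z : ℂ} (hz : 0 < z.im) :
    t2 z ^ 6 * ModularForm.eta z ^ 24 = 2 ^ 24 * ModularForm.eta (2 * z) ^ 48 := by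
  have h1 := triple hz
  have h2 := triple_two hz
  linear_combination (-(t2 z ^ 6) / 256) * h1 +
    ((t2 z ^ 4 * (t3 z * t4 z) + 2 ^ 16 * ModularForm.eta (2 * z) ^ 24) / 256) * h2

lemma eta_diff : DifferentiableOn ℂ ModularForm.eta HH := fun _ hz =>
  (deriv_eta hz).differentiableAt.differentiableWithinAt

lemma eta_two_diff : DifferentiableOn ℂ (fun z => ModularForm.eta (2 * z)) HH :=
  eta_diff.comp (by fun_prop) fun _ hz => two_im hz

def FF (z : ℂ) : ℂ := t2 z ^ 2 * ModularForm.eta z ^ 8 / ModularForm.eta (2 * z) ^ 16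

lemma eta_ne {z : ℂ} (hz : 0 < z.im) : ModularForm.eta z ≠ 0 := ModularForm.eta_ne_zero hz

lemma FF_diff : DifferentiableOn ℂ FF HH :=
  ((t2_diff.pow 2).mul (eta_diff.pow 8)).div (eta_two_diff.pow 16)
    fun _ hz => pow_ne_zero _ (eta_ne (two_im hz))

lemma FF_cube {z : ℂ} (hz : 0 < z.im) : FF z ^ 3 = 2 ^ 24 := by
  have h := eta_ne (two_im hz)
  rw [FF, div_pow, div_eq_iff (by positivity)]
  linear_combination six hz

lemma FF_eq {z : ℂ} (hz : 0 < z.im) : FF z = 256 := by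
  have hne : ∀ w : ℂ, 0 < w.im → FF w ≠ 0 := by
    intro w hw h
    have := FF_cube hw
    rw [h] at this
    norm_num at this
  have hder : ∀ w ∈ HH, deriv FF w = 0 := by
    intro w hw
    have h1 := ((differentiableAt_of FF_diff hw).hasDerivAt).fun_pow 3
    have h2 : HasDerivAt (fun w => FF w ^ 3) 0 w :=
      (hasDerivAt_const w ((2 : ℂ) ^ 24)).congr_of_eventuallyEq (by
        filter_upwards [HH_nhds hw] with u hu using FF_cube hu)
    have h3 := h1.unique h2
    simpa [hne w hw] using h3
  obtain ⟨a, ha⟩ := isOpen_HH.exists_is_const_of_deriv_eq_zero convex_HH.isPreconnected FF_diff hder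
  have hl : Tendsto (fun z => jj z ^ 8 * euler (cexp (2 * π * I * z)) ^ 8 /
      euler (cexp (2 * π * I * (2 * z))) ^ 16) infty (𝓝 256) := by
    have := ((jj_infty.pow 8).mul (euler_infty.pow 8)).div
      ((euler_infty.comp tendsto_two_mul).pow 16) (by norm_num)
    norm_num at this
    exact this
  have hu : a = 256 := by
    refine tendsto_nhds_unique (tendsto_const_nhds (x := a) (f := infty)) (hl.congr' ?_)
    filter_upwards [HH_mem_infty] with w hw
    rw [← ha w hw, FF, t2_sq, eta_euler, eta_euler]
    have e1 : cexp (π * I * (2 * w) / 12) ^ 16 =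
        cexp (2 * π * I * w) * cexp (π * I * w / 12) ^ 8 := by
      rw [← Complex.exp_nat_mul, ← Complex.exp_nat_mul, ← Complex.exp_add]
      congr 1
      push_cast
      ring
    rw [mul_pow, mul_pow, e1]
    have e2 := Complex.exp_ne_zero (2 * π * I * w)
    have e3 := pow_ne_zero 8 (Complex.exp_ne_zero (π * I * w / 12))
    rw [show cexp (2 * π * I * w) * jj w ^ 8 *
      (cexp (π * I * w / 12) ^ 8 * euler (cexp (2 * π * I * w)) ^ 8) =
      (cexp (2 * π * I * w) * cexp (π * I * w / 12) ^ 8) *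
        (jj w ^ 8 * euler (cexp (2 * π * I * w)) ^ 8) by ring,
      mul_div_mul_left _ _ (mul_ne_zero e2 e3)]
  rw [← hu]
  exact ha z hz

lemma C44_eq {z : ℂ} (hz : 0 < z.im) : C44 z = t2 z ^ 2 / 4 := by
  have h := FF_eq hz
  have h1 := eta_ne (two_im hz)
  have h2 := eta_ne hz
  rw [FF, div_eq_iff (by positivity)] at h
  rw [C44, eta_eq, div_eq_iff (by positivity)]
  linear_combination -h / 4

lemma t2_ne {z : ℂ} (hz : 0 < z.im) : t2 z ≠ 0 := by
  intro h
  have := FF_eq hz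
  rw [FF, h] at this
  norm_num at this

lemma B4_eq {z : ℂ} (hz : 0 < z.im) : B4 z ^ 4 = t3 z * t4 z := by
  have h := FF_eq hz
  have h1 := eta_ne (two_im hz)
  have h2 := eta_ne hz
  have h3 := t2_ne hz
  have h4 := triple_two hz
  rw [FF, div_eq_iff (by positivity)] at h
  rw [B4, eta_eq, div_pow, div_eq_iff (by positivity)]
  apply mul_left_cancel₀ (pow_ne_zero 4 h3)
  linear_combination (t2 z ^ 2 * ModularForm.eta z ^ 8 + 256 * ModularForm.eta (2 * z) ^ 16) * h
    - ModularForm.eta (2 * z) ^ 8 * h4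

lemma X4_eq {z : ℂ} (hz : 0 < z.im) : X4 z = (t3 z + t4 z) / 2 := by
  have h2 : theta2 z = v2 (2 * z) := (v2_two z).symm
  have h3 : theta3 z = v3 (2 * z) := (v3_two z).symm
  have e2 := t2_two hz
  have e3 := t3_two hz
  rw [X4, h2, h3]
  rw [t2] at e2
  rw [t3] at e3
  rw [e2, e3, t3, t4]
  ring

lemma quartic {z : ℂ} (hz : 0 < z.im) : X4 z ^ 2 = B4 z ^ 4 + C44 z := by
  rw [X4_eq hz, B4_eq hz, C44_eq hz]
  linear_combination (t3 z - t4 z + t2 z) / 4 * jacobi hz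

lemma X4_e2 {z : ℂ} (hz : 0 < z.im) : X4 z = 2 * e2 (2 * z) - e2 z := by
  rw [X4_eq hz, weight_two hz]

lemma deriv_eta_two {z : ℂ} (hz : 0 < z.im) :
    HasDerivAt (fun w => ModularForm.eta (2 * w))
      (ModularForm.eta (2 * z) * (π * I / 6 * e2 (2 * z))) z := by
  have h1 := deriv_eta (two_im hz)
  have h2 : HasDerivAt (fun w : ℂ => 2 * w) 2 z := by
    simpa using (hasDerivAt_id z).const_mul (2 : ℂ)
  refine HasDerivAt.congr_deriv (HasDerivAt.comp z h1 h2) ?_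
  ring

lemma C44_deriv {z : ℂ} (hz : 0 < z.im) :
    HasDerivAt C44 (C44 z * (2 * π * I * ((4 * e2 (2 * z) - e2 z) / 3))) z := by
  have h1 := eta_ne (two_im hz)
  have h2 := eta_ne hz
  have h := (((deriv_eta_two hz).fun_pow 16).const_mul 64).fun_div ((deriv_eta hz).fun_pow 8)
    (pow_ne_zero _ h2)
  have e : C44 = fun w => 64 * ModularForm.eta (2 * w) ^ 16 / ModularForm.eta w ^ 8 := by
    funext w
    rw [C44, eta_eq]
  rw [e]
  refine HasDerivAt.congr_deriv h ?_
  norm_num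
  field_simp
  ring

lemma B4_deriv {z : ℂ} (hz : 0 < z.im) :
    HasDerivAt (fun t => B4 t ^ 4) (B4 z ^ 4 * (2 * π * I * (2 * (e2 z - e2 (2 * z)) / 3))) z := by
  have h1 := eta_ne (two_im hz)
  have h2 := eta_ne hz
  have h := ((deriv_eta hz).fun_pow 16).fun_div ((deriv_eta_two hz).fun_pow 8)
    (pow_ne_zero _ h1)
  have e : (fun t => B4 t ^ 4) =
      fun w => ModularForm.eta w ^ 16 / ModularForm.eta (2 * w) ^ 8 := by
    funext w
    rw [B4, eta_eq, div_pow, ← pow_mul, ← pow_mul]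
  have e' : B4 z ^ 4 = ModularForm.eta z ^ 16 / ModularForm.eta (2 * z) ^ 8 := congrFun e z
  rw [e, e']
  refine HasDerivAt.congr_deriv h ?_
  norm_num
  field_simp
  ring

lemma tpi_ne : (2 * π * I : ℂ) ≠ 0 := Complex.two_pi_I_ne_zero

lemma E4sig_eq {z : ℂ} (hz : 0 < z.im) : E4sig z = (4 * e2 (2 * z) - e2 z) / 3 := by
  have h0 : C44 z ≠ 0 := by
    rw [C44_eq hz]
    exact div_ne_zero (pow_ne_zero 2 (t2_ne hz)) (by norm_num)
  have hp := tpi_ne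
  rw [E4sig, dq, (C44_deriv hz).deriv, div_eq_iff h0]
  rw [show C44 z * (2 * π * I * ((4 * e2 (2 * z) - e2 z) / 3)) =
    (2 * π * I) * ((4 * e2 (2 * z) - e2 z) / 3 * C44 z) by ring, inv_mul_cancel_left₀ hp]

lemma third {z : ℂ} (hz : 0 < z.im) :
    dq (fun t => B4 t ^ 4) z = E4sig z * B4 z ^ 4 - X4 z * B4 z ^ 4 := by
  have hp := tpi_ne
  rw [dq, (B4_deriv hz).deriv, E4sig_eq hz, X4_e2 hz]
  rw [show B4 z ^ 4 * (2 * π * I * (2 * (e2 z - e2 (2 * z)) / 3)) =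
    (2 * π * I) * (2 * (e2 z - e2 (2 * z)) / 3 * B4 z ^ 4) by ring, inv_mul_cancel_left₀ hp]
  ring

lemma second {z : ℂ} (hz : 0 < z.im) :
    dq (fun t => X4 t ^ 2) z = E4sig z * X4 z ^ 2 - X4 z * B4 z ^ 4 := by
  have hp := tpi_ne
  have h1 : deriv (fun t => X4 t ^ 2) z = deriv (fun t => B4 t ^ 4 + C44 t) z := by
    apply Filter.EventuallyEq.deriv_eq
    filter_upwards [HH_nhds hz] with w hw using quartic hw
  have h2 := ((B4_deriv hz).fun_add (C44_deriv hz)).deriv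
  rw [dq, h1, h2, quartic hz, E4sig_eq hz, X4_e2 hz]
  rw [show B4 z ^ 4 * (2 * π * I * (2 * (e2 z - e2 (2 * z)) / 3)) +
    C44 z * (2 * π * I * ((4 * e2 (2 * z) - e2 z) / 3)) =
    (2 * π * I) * (2 * (e2 z - e2 (2 * z)) / 3 * B4 z ^ 4 +
      (4 * e2 (2 * z) - e2 z) / 3 * C44 z) by ring, inv_mul_cancel_left₀ hp]
  ring

lemma fourth {z : ℂ} (hz : 0 < z.im) :
    4 * dq E4sig z = E4sig z ^ 2 - B4 z ^ 4 := by
  have h1 : deriv E4sig z = deriv (fun w => (4 * e2 (2 * w) - e2 w) / 3) z := by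
    apply Filter.EventuallyEq.deriv_eq
    filter_upwards [HH_nhds hz] with w hw using E4sig_eq hw
  have ha := (differentiableAt_of e2_diff hz).hasDerivAt
  have hb : HasDerivAt (fun w => e2 (2 * w)) (deriv e2 (2 * z) * 2) z := by
    have h2 : HasDerivAt (fun w : ℂ => 2 * w) 2 z := by
      simpa using (hasDerivAt_id z).const_mul (2 : ℂ)
    exact HasDerivAt.comp z (differentiableAt_of e2_diff (two_im hz)).hasDerivAt h2
  have hc := (((hb.const_mul 4).fun_sub ha).div_const 3).deriv
  have r1 := ramanujan hz
  have r2 := ramanujan (two_im hz)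
  have hx : (t3 z + t4 z) / 2 = 2 * e2 (2 * z) - e2 z := weight_two hz
  have hj : t2 z = t3 z - t4 z := by linear_combination -jacobi hz
  rw [t2_two hz, t3_two hz, t4_two hz] at r2
  rw [dq, h1, hc, E4sig_eq hz, B4_eq hz]
  rw [hj] at r1
  simp only [t3, t4] at r1 hx ⊢
  linear_combination (8 / 9 : ℂ) * r2 - r1 / 9 +
    (2 / 9 : ℂ) * ((v3 z ^ 4 + v4 z ^ 4) / 2 + (2 * e2 (2 * z) - e2 z)) * hx

end Sig4
end

theorem signature4_quartic_identity_and_system (τ : ℂ) (hτ : 0 < τ.im) :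
    X4 τ ^ 2 = B4 τ ^ 4 + C44 τ ∧
    dq (fun t => X4 t ^ 2) τ = E4sig τ * X4 τ ^ 2 - X4 τ * B4 τ ^ 4 ∧
    dq (fun t => B4 t ^ 4) τ = E4sig τ * B4 τ ^ 4 - X4 τ * B4 τ ^ 4 ∧
    4 * dq E4sig τ = E4sig τ ^ 2 - B4 τ ^ 4 := by
  exact ⟨Sig4.quartic hτ, Sig4.second hτ, Sig4.third hτ, Sig4.fourth hτ⟩
end
end
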